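/- Let t₁, t₂, t₃ > 0. Then for all m, n ∈ ℕ the polynomials V_n are orthogonal with respect to the (signed) density v(x) = 2z ∏_{j=1}^{3}(−t_j z, t_j/z;q)_∞ / [(q, −z², −q/z²;q)_∞ · log(1/q) · ∏_{1≤j<k≤3}(−t_j t_k/q;q)_∞] (z = z(x)); all moments ∫_ℝ |x|^n |v(x)| dx are finite and ∫_ℝ V_n(x;t|q) V_m(x;t|q) v(x) dx = δ_{m,n} · (q;q)_n (−q²/(t₁t₃);q)_n / [(−q²/(t₁t₂);q)_n (−q²/(t₂t₃);q)_n] · (t₁²/q³)^n. -/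

import Mathlib

noncomputable section

open scoped BigOperators
open Finset MeasureTheory Filter Topology

/-- The finite q-shifted factorial `(a;q)_n`. -/
def qp (q a : ℝ) (n : ℕ) : ℝ := ∏ j ∈ Finset.range n, (1 - a * q ^ j)

/-- The infinite q-shifted factorial `(a;q)_∞`. -/
def qpi (q a : ℝ) : ℝ := ∏' j : ℕ, (1 - a * q ^ j)

/-- `z(x) = x + √(x²+1)`, so that `2x = z - 1/z`. -/
def zx (x : ℝ) : ℝ := x + Real.sqrt (x ^ 2 + 1)

/-- The Askey–Wilson type polynomial `p_n(x, t)`. -/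
def pAW (q t1 t2 t3 t4 : ℝ) (n : ℕ) (x : ℝ) : ℝ :=
  (t1 / q) ^ n * qp q (-q ^ 2 / (t1 * t2)) n * qp q (-q ^ 2 / (t1 * t3)) n *
    qp q (-q ^ 2 / (t1 * t4)) n *
  ∑ k ∈ Finset.range (n + 1),
    qp q (q ^ (-(n : ℤ))) k * qp q (q ^ (n + 3) / (t1 * t2 * t3 * t4)) k *
      qp q (-q / (t1 * zx x)) k * qp q (q * zx x / t1) k * q ^ k /
    (qp q q k * qp q (-q ^ 2 / (t1 * t2)) k * qp q (-q ^ 2 / (t1 * t3)) k *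
      qp q (-q ^ 2 / (t1 * t4)) k)

/-- The normalized weight function `w(x, t)`. -/
def wAW (q t1 t2 t3 t4 : ℝ) (x : ℝ) : ℝ :=
  2 * zx x * qpi q (t1 * t2 * t3 * t4 / q ^ 3) *
    (qpi q (-t1 * zx x) * qpi q (t1 / zx x) * qpi q (-t2 * zx x) * qpi q (t2 / zx x) *
      qpi q (-t3 * zx x) * qpi q (t3 / zx x) * qpi q (-t4 * zx x) * qpi q (t4 / zx x)) /
  (qpi q q * qpi q (-(zx x) ^ 2) * qpi q (-q / (zx x) ^ 2) * Real.log (1 / q) *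
    (qpi q (-t1 * t2 / q) * qpi q (-t1 * t3 / q) * qpi q (-t1 * t4 / q) *
      qpi q (-t2 * t3 / q) * qpi q (-t2 * t4 / q) * qpi q (-t3 * t4 / q)))

/-- The polynomial `V_n(x; t₁,t₂,t₃ | q)`. -/
def Vp (q t1 t2 t3 : ℝ) (n : ℕ) (x : ℝ) : ℝ :=
  (t1 / q) ^ n * (qp q (-q ^ 2 / (t1 * t3)) n / qp q (-q ^ 2 / (t2 * t3)) n) *
  ∑ k ∈ Finset.range (n + 1),
    qp q (q ^ (-(n : ℤ))) k * qp q (-q / (t1 * zx x)) k * qp q (q * zx x / t1) k /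
      (qp q q k * qp q (-q ^ 2 / (t1 * t3)) k * qp q (-q ^ 2 / (t1 * t2)) k) *
      (-q ^ (n + 2) / (t2 * t3)) ^ k

/-- The (signed) density for the infinite family. -/
def vW (q t1 t2 t3 : ℝ) (x : ℝ) : ℝ :=
  2 * zx x *
    (qpi q (-t1 * zx x) * qpi q (t1 / zx x) * qpi q (-t2 * zx x) * qpi q (t2 / zx x) *
      qpi q (-t3 * zx x) * qpi q (t3 / zx x)) /
  (qpi q q * qpi q (-(zx x) ^ 2) * qpi q (-q / (zx x) ^ 2) * Real.log (1 / q) *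
    (qpi q (-t1 * t2 / q) * qpi q (-t1 * t3 / q) * qpi q (-t2 * t3 / q)))

section QPochhammer

variable {q : ℝ}

lemma summable_norm_neg_mul_pow (hq0 : 0 < q) (hq1 : q < 1) (a : ℝ) :
    Summable fun j : ℕ => ‖-(a * q ^ j)‖ := by
  simpa [abs_mul, abs_of_pos hq0] using
    (summable_geometric_of_lt_one hq0.le hq1).mul_left |a|

lemma multipliable_qpi (hq0 : 0 < q) (hq1 : q < 1) (a : ℝ) :
    Multipliable fun j : ℕ => 1 - a * q ^ j := by
  simpa [sub_eq_add_neg] using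
    multipliable_one_add_of_summable (summable_norm_neg_mul_pow hq0 hq1 a)

lemma tendsto_qp_qpi (hq0 : 0 < q) (hq1 : q < 1) (a : ℝ) :
    Tendsto (fun n => qp q a n) atTop (𝓝 (qpi q a)) :=
  (multipliable_qpi hq0 hq1 a).tendsto_prod_tprod_nat

lemma qpi_eq_mul (hq0 : 0 < q) (hq1 : q < 1) (a : ℝ) :
    qpi q a = (1 - a) * qpi q (a * q) := by
  have h := (multipliable_qpi hq0 hq1 (a * q))
  have h2 := tprod_eq_zero_mul' (f := fun j : ℕ => 1 - a * q ^ j)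
    (by simpa [pow_succ', mul_assoc] using h)
  simpa [qpi, pow_succ', mul_assoc] using h2

lemma qpi_zero : qpi q 0 = 1 := by simp [qpi]

lemma abs_qpi_sub_one_le (hq0 : 0 < q) (hq1 : q < 1) (a : ℝ) :
    |qpi q a - 1| ≤ Real.exp (|a| / (1 - q)) - 1 := by
  refine le_of_tendsto ((tendsto_qp_qpi hq0 hq1 a).sub_const 1).abs (Eventually.of_forall ?_)
  intro n
  have h := Finset.norm_prod_one_add_sub_one_le (Finset.range n) (fun j => -(a * q ^ j))
  simp only [← sub_eq_add_neg, Real.norm_eq_abs] at h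
  refine h.trans (sub_le_sub_right (Real.exp_le_exp.mpr ?_) 1)
  have hs := summable_norm_neg_mul_pow hq0 hq1 a
  refine (hs.sum_le_tsum (Finset.range n) fun _ _ => norm_nonneg _).trans_eq ?_
  simp [abs_of_pos hq0, tsum_mul_left, tsum_geometric_of_lt_one hq0.le hq1, div_eq_mul_inv]

lemma tendsto_qpi_of_tendsto_zero (hq0 : 0 < q) (hq1 : q < 1) {u : ℕ → ℝ}
    (hu : Tendsto u atTop (𝓝 0)) : Tendsto (fun n => qpi q (u n)) atTop (𝓝 1) := by
  rw [tendsto_iff_dist_tendsto_zero]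
  refine squeeze_zero (fun _ => dist_nonneg)
    (fun n => (Real.dist_eq _ _).trans_le (abs_qpi_sub_one_le hq0 hq1 (u n))) ?_
  have h : Continuous fun x : ℝ => Real.exp (|x| / (1 - q)) - 1 := by fun_prop
  have h2 := (h.tendsto 0).comp hu
  simpa [Function.comp_def] using h2

lemma measurable_qpi (hq0 : 0 < q) (hq1 : q < 1) : Measurable (qpi q) := by
  refine measurable_of_tendsto_metrizable (f := fun n a => qp q a n) (fun n => ?_)
    (tendsto_pi_nhds.mpr (tendsto_qp_qpi hq0 hq1))
  unfold qp
  fun_prop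

lemma abs_qpi_le (hq0 : 0 < q) (hq1 : q < 1) {a u : ℝ} (h : |a| ≤ u) :
    |qpi q a| ≤ qpi q (-u) := by
  refine le_of_tendsto_of_tendsto' (tendsto_qp_qpi hq0 hq1 a).abs (tendsto_qp_qpi hq0 hq1 (-u)) ?_
  intro n
  unfold qp
  rw [Finset.abs_prod]
  refine Finset.prod_le_prod (fun _ _ => abs_nonneg _) fun j _ => ?_
  have hj : 0 < q ^ j := pow_pos hq0 j
  have h1 : |a * q ^ j| ≤ u * q ^ j := by
    rw [abs_mul, abs_of_pos hj]; gcongr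
  rw [abs_le] at *
  constructor <;> nlinarith

lemma one_le_qpi_neg (hq0 : 0 < q) (hq1 : q < 1) {u : ℝ} (h : 0 ≤ u) : 1 ≤ qpi q (-u) := by
  have := abs_qpi_le hq0 hq1 (a := 0) (u := u) (by simpa using h)
  simpa [qpi_zero] using this

lemma qpi_neg_pos (hq0 : 0 < q) (hq1 : q < 1) {u : ℝ} (h : 0 ≤ u) : 0 < qpi q (-u) :=
  zero_lt_one.trans_le (one_le_qpi_neg hq0 hq1 h)

lemma qpi_neg_mono (hq0 : 0 < q) (hq1 : q < 1) {u v : ℝ} (hu : 0 ≤ u) (h : u ≤ v) :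
    qpi q (-u) ≤ qpi q (-v) :=
  (le_abs_self _).trans (abs_qpi_le hq0 hq1 (by rwa [abs_neg, abs_of_nonneg hu]))

lemma qpi_self_ne_zero (hq0 : 0 < q) (hq1 : q < 1) : qpi q q ≠ 0 := by
  have h := tprod_one_add_ne_zero_of_summable (f := fun j : ℕ => -(q * q ^ j)) (fun j => ?_)
    (summable_norm_neg_mul_pow hq0 hq1 q)
  · simpa [qpi, sub_eq_add_neg] using h
  · have : q ^ (j + 1) < 1 := pow_lt_one₀ hq0.le hq1 (by simp)
    rw [pow_succ'] at this
    linarith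

/-- The product of three factors `(-Tu;q)_∞` times any power of `u` is dominated by
`(-qu²;q)_∞`. -/
lemma exists_qpi_cube_mul_pow_le (hq0 : 0 < q) (hq1 : q < 1) {T : ℝ} (hT : 0 ≤ T) (N : ℕ) :
    ∃ C : ℝ, 0 ≤ C ∧ ∀ u : ℝ, 1 ≤ u →
      qpi q (-(T * u)) ^ 3 * u ^ N ≤ C * qpi q (-(q * u ^ 2)) := by
  set A : ℝ := (1 + T) ^ 3 / q ^ (N + 2) with hA
  set U : ℝ := max 1 A with hU
  have hU1 : 1 ≤ U := le_max_left _ _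
  set C : ℝ := qpi q (-(T * (U / q))) ^ 3 * (U / q) ^ N with hC
  have hC0 : 0 ≤ C := by
    have := qpi_neg_pos hq0 hq1 (u := T * (U / q)) (by positivity)
    positivity
  refine ⟨C, hC0, ?_⟩
  have key : ∀ n : ℕ, ∀ u : ℝ, 1 ≤ u → u ≤ U / q * (q⁻¹) ^ n →
      qpi q (-(T * u)) ^ 3 * u ^ N ≤ C * qpi q (-(q * u ^ 2)) := by
    intro n
    induction n with
    | zero =>
      intro u hu huU
      have h1 : 1 ≤ qpi q (-(q * u ^ 2)) := one_le_qpi_neg hq0 hq1 (by positivity)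
      have h0 : 0 < qpi q (-(T * u)) := qpi_neg_pos hq0 hq1 (by positivity)
      rw [pow_zero, mul_one] at huU
      refine le_trans ?_ (le_mul_of_one_le_right hC0 h1)
      have h2 : qpi q (-(T * u)) ≤ qpi q (-(T * (U / q))) :=
        qpi_neg_mono hq0 hq1 (by positivity) (by gcongr)
      rw [hC]
      have := h0.trans_le h2
      gcongr
    | succ n ih =>
      intro u hu huU
      rcases le_total u (U / q) with h | h
      · refine ih u hu (h.trans (le_mul_of_one_le_right (by positivity) ?_))
        exact one_le_pow₀ (one_le_inv_iff₀.mpr ⟨hq0, hq1.le⟩)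
      have hqu : U ≤ q * u := by rw [div_le_iff₀ hq0] at h; linarith
      have hv := ih (q * u) (hU1.trans hqu) (by
        calc q * u ≤ q * (U / q * q⁻¹ ^ (n + 1)) := by gcongr
          _ = U / q * q⁻¹ ^ n := by rw [pow_succ]; field_simp)
      set v := q * u with hvdef
      have hv1 : 1 ≤ v := hU1.trans hqu
      have hu' : u = v / q := by rw [hvdef]; field_simp
      have e1 : qpi q (-(T * u)) = (1 + T * u) * qpi q (-(T * v)) := by
        rw [qpi_eq_mul hq0 hq1, hvdef]; ring_nf
      have e2 : qpi q (-(q * u ^ 2)) = (1 + q * u ^ 2) * ((1 + v ^ 2) * qpi q (-(q * v ^ 2))) := by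
        rw [qpi_eq_mul hq0 hq1, qpi_eq_mul hq0 hq1, hvdef]; ring_nf
      have hA' : (1 + T) ^ 3 ≤ q ^ (N + 2) * v := by
        have : A ≤ v := (le_max_right _ _).trans hqu
        rw [hA, div_le_iff₀ (by positivity)] at this
        linarith
      have hfac : (1 + T * u) ^ 3 * (u ^ N) ≤ (1 + q * u ^ 2) * (1 + v ^ 2) * v ^ N := by
        have b1 : 1 + T * u ≤ (1 + T) * u := by nlinarith
        have b2 : (1 + T * u) ^ 3 ≤ ((1 + T) * u) ^ 3 := by gcongr
        have b4 : (q * u ^ 2) * v ^ 2 ≤ (1 + q * u ^ 2) * (1 + v ^ 2) := by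
          gcongr <;> linarith
        have b5 : ((1 + T) * u) ^ 3 * u ^ N ≤ (q * u ^ 2) * v ^ 2 * v ^ N := by
          calc ((1 + T) * u) ^ 3 * u ^ N = (1 + T) ^ 3 * (u ^ 3 * u ^ N) := by ring
            _ ≤ (q ^ (N + 2) * v) * (u ^ 3 * u ^ N) := by gcongr
            _ = _ := by rw [hvdef]; ring
        calc _ ≤ ((1 + T) * u) ^ 3 * u ^ N := by gcongr
          _ ≤ _ := b5
          _ ≤ _ := by gcongr
      have hp : 0 < qpi q (-(T * v)) := qpi_neg_pos hq0 hq1 (by positivity)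
      have hp2 : 0 < qpi q (-(q * v ^ 2)) := qpi_neg_pos hq0 hq1 (by positivity)
      rw [e1, e2]
      calc ((1 + T * u) * qpi q (-(T * v))) ^ 3 * u ^ N
          = ((1 + T * u) ^ 3 * u ^ N) * qpi q (-(T * v)) ^ 3 := by ring
        _ ≤ ((1 + q * u ^ 2) * (1 + v ^ 2) * v ^ N) * qpi q (-(T * v)) ^ 3 := by gcongr
        _ = ((1 + q * u ^ 2) * (1 + v ^ 2)) * (qpi q (-(T * v)) ^ 3 * v ^ N) := by ring
        _ ≤ ((1 + q * u ^ 2) * (1 + v ^ 2)) * (C * qpi q (-(q * v ^ 2))) := by gcongr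
        _ = _ := by ring
  intro u hu
  obtain ⟨n, hn⟩ := pow_unbounded_of_one_lt (u / (U / q)) (one_lt_inv_iff₀.mpr ⟨hq0, hq1⟩)
  refine key n u hu ?_
  rw [div_lt_iff₀ (by positivity)] at hn
  linarith

end QPochhammer

section Weight

variable {q : ℝ}

/-- The factor `(-tz, t/z;q)_∞`. -/
def ladder (q t z : ℝ) : ℝ := qpi q (-(t * z)) * qpi q (t / z)

/-- The factor `(-qz², -q/z²;q)_∞`. -/
def thetaDen (q z : ℝ) : ℝ := qpi q (-(q * z ^ 2)) * qpi q (-(q / z ^ 2))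

/-- The weight, without normalization, with respect to `dz/z` on `(0,∞)`. -/
def wz (q t1 t2 t3 z : ℝ) : ℝ :=
  ladder q t1 z * ladder q t2 z * ladder q t3 z / thetaDen q z

lemma wz_swap12 (q t1 t2 t3 z : ℝ) : wz q t1 t2 t3 z = wz q t2 t1 t3 z := by
  simp only [wz]; ring

lemma wz_swap23 (q t1 t2 t3 z : ℝ) : wz q t1 t2 t3 z = wz q t1 t3 t2 z := by
  simp only [wz]; ring

lemma ladder_div (hq0 : 0 < q) (hq1 : q < 1) (t z : ℝ) :
    ladder q (t / q) z = (1 + t / q * z) * (1 - t / q / z) * ladder q t z := by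
  rw [ladder, qpi_eq_mul hq0 hq1, qpi_eq_mul hq0 hq1 (t / q / z), ladder]
  rw [show -(t / q * z) * q = -(t * z) by field_simp, show t / q / z * q = t / z by field_simp]
  ring

lemma ladder_shift (hq0 : 0 < q) (hq1 : q < 1) (t : ℝ) {z : ℝ} (hz : 0 < z) :
    ladder q t (z / q) * (1 - t / z) = ladder q t z * (1 + t * z / q) := by
  rw [ladder, qpi_eq_mul hq0 hq1 (-(t * (z / q))), ladder, qpi_eq_mul hq0 hq1 (t / z)]
  rw [show -(t * (z / q)) * q = -(t * z) by field_simp, show t / (z / q) = t / z * q by field_simp]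
  ring

lemma thetaDen_pos (hq0 : 0 < q) (hq1 : q < 1) (z : ℝ) : 0 < thetaDen q z :=
  mul_pos (qpi_neg_pos hq0 hq1 (by positivity)) (qpi_neg_pos hq0 hq1 (by positivity))

lemma thetaDen_shift (hq0 : 0 < q) (hq1 : q < 1) {z : ℝ} (hz : 0 < z) :
    thetaDen q (z / q) * (q ^ 3 * (1 + z ^ 2 / q ^ 2)) =
      thetaDen q z * (z ^ 4 * (1 + z ^ 2)) := by
  have h1 : qpi q (-(q * (z / q) ^ 2)) = (1 + z ^ 2 / q) * ((1 + z ^ 2) * qpi q (-(q * z ^ 2))) := by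
    rw [qpi_eq_mul hq0 hq1, qpi_eq_mul hq0 hq1]
    rw [show -(q * (z / q) ^ 2) * q * q = -(q * z ^ 2) by field_simp]
    field_simp
    ring
  have h2 : qpi q (-(q / z ^ 2)) =
      (1 + q / z ^ 2) * ((1 + q ^ 2 / z ^ 2) * qpi q (-(q / (z / q) ^ 2))) := by
    rw [qpi_eq_mul hq0 hq1, qpi_eq_mul hq0 hq1]
    rw [show -(q / z ^ 2) * q * q = -(q / (z / q) ^ 2) by field_simp]
    ring
  rw [thetaDen, thetaDen, h1, h2]
  field_simp
  ring

lemma measurable_wz (hq0 : 0 < q) (hq1 : q < 1) (t1 t2 t3 : ℝ) : Measurable (wz q t1 t2 t3) := by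
  have h := measurable_qpi hq0 hq1
  unfold wz ladder thetaDen
  fun_prop

lemma ladder_neg_bound (hq0 : 0 < q) (hq1 : q < 1) {t T z : ℝ} (ht : |t| ≤ T) (hz : 0 < z) :
    |ladder q t z| ≤ qpi q (-(T * z)) * qpi q (-(T / z)) := by
  have hT : 0 ≤ T := (abs_nonneg t).trans ht
  rw [ladder, abs_mul]
  gcongr
  · exact (qpi_neg_pos hq0 hq1 (by positivity)).le
  · refine abs_qpi_le hq0 hq1 ?_
    rw [abs_neg, abs_mul, abs_of_pos hz]; gcongr
  · refine abs_qpi_le hq0 hq1 ?_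
    rw [abs_div, abs_of_pos hz]; gcongr

lemma exists_wz_bound (hq0 : 0 < q) (hq1 : q < 1) {T : ℝ} (hT : 0 ≤ T) (N : ℕ) :
    ∃ C : ℝ, 0 ≤ C ∧ ∀ t1 t2 t3 : ℝ, |t1| ≤ T → |t2| ≤ T → |t3| ≤ T → ∀ y : ℝ,
      |wz q t1 t2 t3 (Real.exp y)| * Real.exp |y| ^ N ≤ C := by
  obtain ⟨C, hC0, hC⟩ := exists_qpi_cube_mul_pow_le hq0 hq1 hT N
  have hE : 0 < qpi q (-T) := qpi_neg_pos hq0 hq1 hT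
  refine ⟨C * qpi q (-T) ^ 3, by positivity, fun t1 t2 t3 h1 h2 h3 y => ?_⟩
  set u := Real.exp |y| with hu
  have hu1 : 1 ≤ u := Real.one_le_exp (abs_nonneg y)
  have hu0 : 0 < u := Real.exp_pos _
  have hz : 0 < Real.exp y := Real.exp_pos y
  have hnum : qpi q (-(T * Real.exp y)) * qpi q (-(T / Real.exp y)) =
      qpi q (-(T * u)) * qpi q (-(T / u)) := by
    rcases abs_cases y with ⟨h, _⟩ | ⟨h, _⟩ <;> rw [hu, h]
    rw [Real.exp_neg, mul_comm]
    simp [div_eq_mul_inv]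
  have hden : thetaDen q (Real.exp y) = qpi q (-(q * u ^ 2)) * qpi q (-(q / u ^ 2)) := by
    rcases abs_cases y with ⟨h, _⟩ | ⟨h, _⟩ <;> rw [hu, h, thetaDen]
    rw [Real.exp_neg, mul_comm]
    simp [div_eq_mul_inv]
  have hP : 0 < qpi q (-(T * u)) := qpi_neg_pos hq0 hq1 (by positivity)
  have hP' : 0 < qpi q (-(T / u)) := qpi_neg_pos hq0 hq1 (by positivity)
  have hPT : qpi q (-(T / u)) ≤ qpi q (-T) :=
    qpi_neg_mono hq0 hq1 (by positivity) (div_le_self hT hu1)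
  have hD1 : 1 ≤ qpi q (-(q / u ^ 2)) := one_le_qpi_neg hq0 hq1 (by positivity)
  have hD : 0 < qpi q (-(q * u ^ 2)) := qpi_neg_pos hq0 hq1 (by positivity)
  have b : ∀ {t}, |t| ≤ T → |ladder q t (Real.exp y)| ≤ qpi q (-(T * u)) * qpi q (-T) := by
    intro t ht
    refine (ladder_neg_bound hq0 hq1 ht hz).trans ?_
    rw [hnum]
    gcongr
  rw [wz, abs_div, abs_of_pos (thetaDen_pos hq0 hq1 _), div_mul_eq_mul_div,
    div_le_iff₀ (thetaDen_pos hq0 hq1 _), abs_mul, abs_mul, hden]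
  calc |ladder q t1 (Real.exp y)| * |ladder q t2 (Real.exp y)| * |ladder q t3 (Real.exp y)| * u ^ N
      ≤ (qpi q (-(T * u)) * qpi q (-T)) * (qpi q (-(T * u)) * qpi q (-T)) *
        (qpi q (-(T * u)) * qpi q (-T)) * u ^ N := by
        gcongr
        · exact b h1
        · exact b h2
        · exact b h3
    _ = (qpi q (-(T * u)) ^ 3 * u ^ N) * qpi q (-T) ^ 3 := by ring
    _ ≤ (C * qpi q (-(q * u ^ 2))) * qpi q (-T) ^ 3 := by
        exact mul_le_mul_of_nonneg_right (hC u hu1) (by positivity)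
    _ = C * qpi q (-T) ^ 3 * (qpi q (-(q * u ^ 2)) * 1) := by ring
    _ ≤ _ := by gcongr

lemma one_add_sq_le_exp_abs_sq (y : ℝ) : 1 + y ^ 2 ≤ Real.exp |y| ^ 2 := by
  have h := Real.add_one_le_exp |y|
  have h0 := abs_nonneg y
  rw [← sq_abs y]
  nlinarith

/-- A dominating function that is uniform in the parameters. -/
lemma exists_integrable_dominating (hq0 : 0 < q) (hq1 : q < 1) {T : ℝ} (hT : 0 ≤ T) (N : ℕ)
    (A : ℝ) :
    ∃ B : ℝ → ℝ, Integrable B ∧ ∀ t1 t2 t3 : ℝ, |t1| ≤ T → |t2| ≤ T → |t3| ≤ T →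
      ∀ f : ℝ → ℝ, (∀ y, |f y| ≤ A * Real.exp |y| ^ N) →
        ∀ y, ‖f y * wz q t1 t2 t3 (Real.exp y)‖ ≤ B y := by
  obtain ⟨C, hC0, hC⟩ := exists_wz_bound hq0 hq1 hT (N + 2)
  refine ⟨fun y => |A| * C * (1 + y ^ 2)⁻¹, integrable_inv_one_add_sq.const_mul _, ?_⟩
  intro t1 t2 t3 h1 h2 h3 f hf y
  have hu0 : 0 < Real.exp |y| := Real.exp_pos _
  have hw := hC t1 t2 t3 h1 h2 h3 y
  rw [Real.norm_eq_abs, abs_mul]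
  calc |f y| * |wz q t1 t2 t3 (Real.exp y)|
      ≤ (|A| * Real.exp |y| ^ N) * |wz q t1 t2 t3 (Real.exp y)| := by
        gcongr
        exact (hf y).trans (by gcongr; exact le_abs_self A)
    _ = |A| * (|wz q t1 t2 t3 (Real.exp y)| * Real.exp |y| ^ (N + 2)) * (Real.exp |y| ^ 2)⁻¹ := by
        rw [pow_add]; field_simp
    _ ≤ |A| * C * (1 + y ^ 2)⁻¹ := by
        gcongr
        exact one_add_sq_le_exp_abs_sq y

lemma integrable_mul_wz (hq0 : 0 < q) (hq1 : q < 1) (t1 t2 t3 : ℝ) {f : ℝ → ℝ}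
    (hfm : Measurable f) (A : ℝ) (N : ℕ) (hf : ∀ y, |f y| ≤ A * Real.exp |y| ^ N) :
    Integrable fun y => f y * wz q t1 t2 t3 (Real.exp y) := by
  obtain ⟨B, hB, h⟩ := exists_integrable_dominating hq0 hq1
    (T := max |t1| (max |t2| |t3|)) (by positivity) N A
  refine hB.mono' ?_ (Eventually.of_forall (h t1 t2 t3 (by simp) (by simp) (by simp) f hf))
  exact (hfm.mul ((measurable_wz hq0 hq1 t1 t2 t3).comp Real.measurable_exp)).aestronglyMeasurable

lemma integrable_wz (hq0 : 0 < q) (hq1 : q < 1) (t1 t2 t3 : ℝ) :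
    Integrable fun y => wz q t1 t2 t3 (Real.exp y) := by
  simpa using integrable_mul_wz hq0 hq1 t1 t2 t3 (f := fun _ => 1) measurable_const 1 0 (by simp)

lemma exp_le_exp_abs (y : ℝ) : Real.exp y ≤ Real.exp |y| := Real.exp_le_exp.mpr (le_abs_self y)

lemma inv_exp_le_exp_abs (y : ℝ) : (Real.exp y)⁻¹ ≤ Real.exp |y| := by
  rw [← Real.exp_neg]; exact Real.exp_le_exp.mpr (neg_le_abs y)

lemma integrable_two_sinh_mul_wz (hq0 : 0 < q) (hq1 : q < 1) (t1 t2 t3 : ℝ) :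
    Integrable fun y => (Real.exp y - (Real.exp y)⁻¹) * wz q t1 t2 t3 (Real.exp y) := by
  refine integrable_mul_wz hq0 hq1 t1 t2 t3 (by fun_prop) 1 1 fun y => ?_
  have h1 := exp_le_exp_abs y
  have h2 := inv_exp_le_exp_abs y
  have h3 : 0 < (Real.exp y)⁻¹ := by positivity
  have h4 := Real.exp_pos y
  rw [abs_le]
  constructor <;> linarith

/-- The total mass `∫ w(z) dz/z`. -/
def mass (q t1 t2 t3 : ℝ) : ℝ := ∫ y : ℝ, wz q t1 t2 t3 (Real.exp y)

lemma wz_shift (hq0 : 0 < q) (hq1 : q < 1) (t1 t2 t3 : ℝ) {z : ℝ} (hz : 0 < z) :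
    wz q t1 t2 t3 (z / q) * ((1 - t1 / z) * (1 - t2 / z) * (1 - t3 / z)) *
        ((z / q) ^ 3 / (1 + (z / q) ^ 2)) =
      wz q t1 t2 t3 z * ((1 + t1 * z / q) * (1 + t2 * z / q) * (1 + t3 * z / q)) /
        (z * (1 + z ^ 2)) := by
  have e1 := ladder_shift hq0 hq1 t1 hz
  have e2 := ladder_shift hq0 hq1 t2 hz
  have e3 := ladder_shift hq0 hq1 t3 hz
  have e4 := thetaDen_shift hq0 hq1 hz
  have d1 := thetaDen_pos hq0 hq1 z
  have d2 := thetaDen_pos hq0 hq1 (z / q)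
  calc wz q t1 t2 t3 (z / q) * ((1 - t1 / z) * (1 - t2 / z) * (1 - t3 / z)) *
        ((z / q) ^ 3 / (1 + (z / q) ^ 2))
      = (ladder q t1 (z / q) * (1 - t1 / z)) * (ladder q t2 (z / q) * (1 - t2 / z)) *
        (ladder q t3 (z / q) * (1 - t3 / z)) * z ^ 3 /
          (thetaDen q (z / q) * (q ^ 3 * (1 + z ^ 2 / q ^ 2))) := by
        rw [wz]; field_simp
    _ = _ := by
        rw [e1, e2, e3, e4, wz]; field_simp

lemma integral_two_sinh_mul_wz (hq0 : 0 < q) (hq1 : q < 1) (t1 t2 t3 : ℝ) :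
    ∫ y : ℝ, (Real.exp y - (Real.exp y)⁻¹) * wz q t1 t2 t3 (Real.exp y) =
      (t1 / q + t2 / q + t3 / q + t1 / q * (t2 / q) * (t3 / q)) * mass q t1 t2 t3 := by
  set c := t1 / q + t2 / q + t3 / q + t1 / q * (t2 / q) * (t3 / q) with hc
  set r : ℝ → ℝ := fun z => (z ^ 3 / (1 + z ^ 2)) *
    ((1 - t1 / q / z) * (1 - t2 / q / z) * (1 - t3 / q / z)) with hr
  set h : ℝ → ℝ := fun y => r (Real.exp y) * wz q t1 t2 t3 (Real.exp y) with hh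
  have htrans : ∫ y, h (y - Real.log q) = ∫ y, h y := integral_sub_right_eq_self h _
  have hexp : ∀ y, Real.exp (y - Real.log q) = Real.exp y / q := fun y => by
    rw [Real.exp_sub, Real.exp_log hq0]
  have hpt : ∀ y, h (y - Real.log q) =
      h y - ((Real.exp y - (Real.exp y)⁻¹) * wz q t1 t2 t3 (Real.exp y) -
        c * wz q t1 t2 t3 (Real.exp y)) := by
    intro y
    have hz := Real.exp_pos y
    simp only [hh, hr, hexp]
    set z := Real.exp y
    have := wz_shift hq0 hq1 t1 t2 t3 hz
    have e : ∀ t, t / q / (z / q) = t / z := fun t => by field_simp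
    rw [e, e, e]
    rw [show ∀ a b w : ℝ, a * b * w = w * b * a by intros; ring, this, hc]
    field_simp
    ring
  have hint : Integrable h := by
    refine integrable_mul_wz hq0 hq1 t1 t2 t3 (f := fun y => r (Real.exp y))
      (by simp only [hr]; fun_prop)
      ((1 + |t1 / q|) * (1 + |t2 / q|) * (1 + |t3 / q|)) 6 fun y => ?_
    have hz := Real.exp_pos y
    have hu1 : 1 ≤ Real.exp |y| := Real.one_le_exp (abs_nonneg y)
    have hzu := exp_le_exp_abs y
    have hzi := inv_exp_le_exp_abs y
    have hs : ∀ s : ℝ, |1 - s / Real.exp y| ≤ (1 + |s|) * Real.exp |y| := by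
      intro s
      calc |1 - s / Real.exp y| ≤ |1| + |s / Real.exp y| := abs_sub _ _
        _ = 1 + |s| * (Real.exp y)⁻¹ := by rw [abs_div, abs_of_pos hz, abs_one]; rfl
        _ ≤ Real.exp |y| + |s| * Real.exp |y| := by gcongr
        _ = _ := by ring
    have hr0 : |Real.exp y ^ 3 / (1 + Real.exp y ^ 2)| ≤ Real.exp |y| ^ 3 := by
      rw [abs_of_pos (by positivity)]
      refine (div_le_self (by positivity) ?_).trans (by gcongr)
      nlinarith
    simp only [hr]
    rw [abs_mul, abs_mul, abs_mul]
    calc _ ≤ Real.exp |y| ^ 3 * (((1 + |t1 / q|) * Real.exp |y|) * ((1 + |t2 / q|) * Real.exp |y|) *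
          ((1 + |t3 / q|) * Real.exp |y|)) := by
          gcongr
          · exact hs _
          · exact hs _
          · exact hs _
      _ = _ := by ring
  have i1 := integrable_two_sinh_mul_wz hq0 hq1 t1 t2 t3
  have i2 := (integrable_wz hq0 hq1 t1 t2 t3).const_mul c
  rw [funext hpt, integral_sub hint (g := fun y => _ - _) (i1.sub i2), integral_sub i1 i2,
    integral_const_mul] at htrans
  rw [mass]
  linarith

/-- The contiguous relation in the first parameter. -/
lemma mass_div (hq0 : 0 < q) (hq1 : q < 1) (t1 t2 t3 : ℝ) :
    mass q (t1 / q) t2 t3 =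
      (1 + t1 * t2 / q ^ 2) * (1 + t1 * t3 / q ^ 2) * mass q t1 t2 t3 := by
  have hpt : ∀ y, wz q (t1 / q) t2 t3 (Real.exp y) =
      (1 - (t1 / q) ^ 2) * wz q t1 t2 t3 (Real.exp y) +
        t1 / q * ((Real.exp y - (Real.exp y)⁻¹) * wz q t1 t2 t3 (Real.exp y)) := by
    intro y
    have hz := Real.exp_pos y
    rw [wz, ladder_div hq0 hq1, wz]
    field_simp
    ring
  have h := integral_two_sinh_mul_wz hq0 hq1 t1 t2 t3
  have i1 := (integrable_two_sinh_mul_wz hq0 hq1 t1 t2 t3).const_mul (t1 / q)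
  have i2 := (integrable_wz hq0 hq1 t1 t2 t3).const_mul (1 - (t1 / q) ^ 2)
  rw [mass, funext hpt, integral_add i2 i1, integral_const_mul, integral_const_mul, h, ← mass]
  field_simp
  ring

end Weight

section NormalizingConstant

variable {q : ℝ}

/-- The integrand `(-au, -b/u;q)_∞ / (-u, -q/u;q)_∞`. -/
def ramW (q a b u : ℝ) : ℝ :=
  qpi q (-(a * u)) * qpi q (-(b / u)) / (qpi q (-u) * qpi q (-(q / u)))

/-- The total mass `∫ (-au, -b/u;q)_∞ / (-u, -q/u;q)_∞ du/u`. -/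
def ramMass (q a b : ℝ) : ℝ := ∫ y : ℝ, ramW q a b (Real.exp y)

lemma measurable_ramW (hq0 : 0 < q) (hq1 : q < 1) (a b : ℝ) : Measurable (ramW q a b) := by
  have h := measurable_qpi hq0 hq1
  unfold ramW
  fun_prop

lemma ramW_nonneg (hq0 : 0 < q) (hq1 : q < 1) {a b u : ℝ} (ha : 0 ≤ a) (hb : 0 ≤ b) (hu : 0 < u) :
    0 ≤ ramW q a b u := by
  have h := fun {v : ℝ} (hv : 0 ≤ v) => (qpi_neg_pos hq0 hq1 hv).le
  exact div_nonneg (mul_nonneg (h (by positivity)) (h (by positivity)))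
    (mul_nonneg (h hu.le) (h (by positivity)))

lemma ramW_mono (hq0 : 0 < q) (hq1 : q < 1) {a b a' b' u : ℝ} (ha : 0 ≤ a) (hb : 0 ≤ b)
    (haa : a ≤ a') (hbb : b ≤ b') (hu : 0 < u) : ramW q a b u ≤ ramW q a' b' u := by
  have h1 := qpi_neg_pos hq0 hq1 hu.le
  have h2 := qpi_neg_pos hq0 hq1 (u := q / u) (by positivity)
  have h3 := qpi_neg_pos hq0 hq1 (u := b / u) (by positivity)
  have h4 := qpi_neg_pos hq0 hq1 (u := a' * u) (mul_nonneg (ha.trans haa) hu.le)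
  unfold ramW
  gcongr
  · exact qpi_neg_mono hq0 hq1 (by positivity) (by gcongr)
  · exact qpi_neg_mono hq0 hq1 (by positivity) (by gcongr)

lemma ramW_q_qsq (hq0 : 0 < q) (hq1 : q < 1) {u : ℝ} (hu : 0 < u) :
    ramW q q (q ^ 2) u = u / ((u + q) * (1 + u)) := by
  have h1 := qpi_neg_pos hq0 hq1 (u := q * u) (by positivity)
  have h2 := qpi_neg_pos hq0 hq1 (u := q ^ 2 / u) (by positivity)
  rw [ramW, qpi_eq_mul hq0 hq1 (-u), qpi_eq_mul hq0 hq1 (-(q / u)),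
    show -u * q = -(q * u) by ring, show -(q / u) * q = -(q ^ 2 / u) by ring,
    sub_neg_eq_add, sub_neg_eq_add, show 1 + q / u = (u + q) / u by field_simp]
  field_simp

lemma ramW_mul_q (hq0 : 0 < q) (hq1 : q < 1) (a b u : ℝ) :
    ramW q a b u = (1 + a * u) * ramW q (a * q) b u := by
  rw [ramW, qpi_eq_mul hq0 hq1 (-(a * u)), show -(a * u) * q = -(a * q * u) by ring, ramW]
  ring

lemma ramW_q_qsq_le (hq0 : 0 < q) (hq1 : q < 1) (y : ℝ) :
    ramW q q (q ^ 2) (Real.exp y) ≤ 2 / q * (1 + y ^ 2)⁻¹ := by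
  have hu := Real.exp_pos y
  have hv := Real.exp_pos |y|
  have hv1 : 1 ≤ Real.exp |y| := Real.one_le_exp (abs_nonneg y)
  have h1 : 1 + y ^ 2 ≤ 2 * Real.exp |y| := by
    have := Real.quadratic_le_exp_of_nonneg (abs_nonneg y)
    rw [sq_abs] at this
    linarith [abs_nonneg y]
  have h2 : q * Real.exp |y| * Real.exp y ≤ (Real.exp y + q) * (1 + Real.exp y) := by
    rcases abs_cases y with ⟨h, _⟩ | ⟨h, _⟩ <;> rw [h]
    · nlinarith [mul_pos hu hu]
    · rw [mul_assoc, ← Real.exp_add]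
      simp only [neg_add_cancel, Real.exp_zero]
      nlinarith [mul_pos hu hu, mul_pos hq0 hu]
  rw [ramW_q_qsq hq0 hq1 hu, div_le_iff₀ (by positivity), ← div_eq_mul_inv, div_div,
    div_mul_eq_mul_div, le_div_iff₀ (by positivity)]
  calc Real.exp y * (q * (1 + y ^ 2)) ≤ Real.exp y * (q * (2 * Real.exp |y|)) := by gcongr
    _ = 2 * (q * Real.exp |y| * Real.exp y) := by ring
    _ ≤ _ := by gcongr

lemma norm_ramW_le (hq0 : 0 < q) (hq1 : q < 1) {a b : ℝ} (ha : 0 ≤ a) (haq : a ≤ q)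
    (hb : 0 ≤ b) (hbq : b ≤ q ^ 2) (y : ℝ) :
    ‖ramW q a b (Real.exp y)‖ ≤ 2 / q * (1 + y ^ 2)⁻¹ := by
  have hu := Real.exp_pos y
  rw [Real.norm_eq_abs, abs_of_nonneg (ramW_nonneg hq0 hq1 ha hb hu)]
  exact (ramW_mono hq0 hq1 ha hb haq hbq hu).trans (ramW_q_qsq_le hq0 hq1 y)

lemma integrable_ramW (hq0 : 0 < q) (hq1 : q < 1) {a b : ℝ} (ha : 0 ≤ a) (haq : a ≤ q)
    (hb : 0 ≤ b) (hbq : b ≤ q ^ 2) : Integrable fun y => ramW q a b (Real.exp y) :=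
  (integrable_inv_one_add_sq.const_mul (2 / q)).mono'
    ((measurable_ramW hq0 hq1 a b).comp Real.measurable_exp).aestronglyMeasurable
    (Eventually.of_forall (norm_ramW_le hq0 hq1 ha haq hb hbq))

lemma integrable_exp_mul_ramW (hq0 : 0 < q) (hq1 : q < 1) {a b : ℝ} (ha : 0 ≤ a)
    (haq : a ≤ q ^ 2) (hb : 0 ≤ b) (hbq : b ≤ q ^ 2) :
    Integrable fun y => Real.exp y * ramW q a b (Real.exp y) := by
  refine (integrable_inv_one_add_sq.const_mul (q⁻¹ * (2 / q))).mono'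
    (Real.measurable_exp.mul
      ((measurable_ramW hq0 hq1 a b).comp Real.measurable_exp)).aestronglyMeasurable
    (Eventually.of_forall fun y => ?_)
  have hu := Real.exp_pos y
  have h0 := ramW_nonneg hq0 hq1 ha hb hu
  rw [Real.norm_eq_abs, abs_of_nonneg (by positivity)]
  have h1 := ramW_mul_q hq0 hq1 q (q ^ 2) (Real.exp y)
  have h2 := ramW_mono hq0 hq1 ha hb (haq.trans_eq (sq q)) hbq hu
  have h3 := ramW_q_qsq_le hq0 hq1 y
  rw [mul_assoc, le_inv_mul_iff₀ hq0]
  calc q * (Real.exp y * ramW q a b (Real.exp y))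
      = (q * Real.exp y) * ramW q a b (Real.exp y) := by ring
    _ ≤ (1 + q * Real.exp y) * ramW q (q * q) (q ^ 2) (Real.exp y) := by
        gcongr
        linarith
    _ ≤ _ := h1.symm.trans_le h3

lemma ramW_shift (hq0 : 0 < q) (hq1 : q < 1) {a b u : ℝ} (hu : 0 < u) :
    (u / q + b / q) * ramW q a b (u / q) = (1 + a / q * u) * ramW q a b u := by
  have h1 := qpi_neg_pos hq0 hq1 hu.le
  have h2 := qpi_neg_pos hq0 hq1 (u := q ^ 2 / u) (by positivity)
  rw [ramW, ramW, qpi_eq_mul hq0 hq1 (-(a * (u / q))), qpi_eq_mul hq0 hq1 (-(u / q)),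
    qpi_eq_mul hq0 hq1 (-(b / u)), qpi_eq_mul hq0 hq1 (-(q / u)),
    show -(a * (u / q)) * q = -(a * u) by field_simp, show -(u / q) * q = -u by field_simp,
    show -(b / u) * q = -(b / (u / q)) by field_simp,
    show -(q / u) * q = -(q ^ 2 / u) by ring,
    show -(q / (u / q)) = -(q ^ 2 / u) by field_simp]
  field_simp
  ring

lemma integral_exp_mul_ramW (hq0 : 0 < q) (hq1 : q < 1) {a b : ℝ} (ha : 0 ≤ a)
    (haq : a ≤ q ^ 2) (hb : 0 ≤ b) (hbq : b ≤ q ^ 2) :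
    (1 - a / q) * ∫ y : ℝ, Real.exp y * ramW q a b (Real.exp y) =
      (1 - b / q) * ramMass q a b := by
  have hexp : ∀ y, Real.exp (y - Real.log q) = Real.exp y / q := fun y => by
    rw [Real.exp_sub, Real.exp_log hq0]
  have i1 := integrable_exp_mul_ramW hq0 hq1 ha haq hb hbq
  have i2 := integrable_ramW hq0 hq1 ha (haq.trans (by nlinarith)) hb hbq
  have htrans := integral_sub_right_eq_self (μ := volume)
    (fun y => (Real.exp y + b / q) * ramW q a b (Real.exp y)) (Real.log q)
  simp only [hexp, ramW_shift hq0 hq1 (Real.exp_pos _)] at htrans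
  simp only [add_mul, one_mul, mul_assoc] at htrans
  rw [integral_add i2 (i1.const_mul _), integral_add i1 (i2.const_mul _), integral_const_mul,
    integral_const_mul] at htrans
  rw [ramMass]
  linarith

lemma ramMass_mul_q (hq0 : 0 < q) (hq1 : q < 1) {a b : ℝ} (ha : 0 ≤ a)
    (haq : a ≤ q) (hb : 0 ≤ b) (hbq : b ≤ q ^ 2) :
    (1 - a) * ramMass q a b = (1 - a * b / q) * ramMass q (a * q) b := by
  have haq' : a * q ≤ q ^ 2 := by nlinarith
  have i1 := integrable_exp_mul_ramW hq0 hq1 (mul_nonneg ha hq0.le) haq' hb hbq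
  have i2 := integrable_ramW hq0 hq1 (mul_nonneg ha hq0.le) (haq'.trans (by nlinarith)) hb hbq
  have h := integral_exp_mul_ramW hq0 hq1 (mul_nonneg ha hq0.le) haq' hb hbq
  rw [mul_div_cancel_right₀ _ hq0.ne'] at h
  have e : ramMass q a b =
      ramMass q (a * q) b + a * ∫ y : ℝ, Real.exp y * ramW q (a * q) b (Real.exp y) := by
    rw [ramMass, ramMass, ← integral_const_mul, ← integral_add i2 (i1.const_mul a)]
    refine integral_congr_ae (Eventually.of_forall fun y => ?_)
    simp only []
    rw [ramW_mul_q hq0 hq1 a b]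
    ring
  rw [e, mul_add, mul_left_comm, h]
  ring

lemma ramMass_symm (hq0 : 0 < q) (a b : ℝ) :
    ramMass q a b = ramMass q (b / q) (a * q) := by
  rw [ramMass, ← integral_sub_left_eq_self _ volume (Real.log q), ramMass]
  refine integral_congr_ae (Eventually.of_forall fun y => ?_)
  have hu := Real.exp_pos y
  simp only [Real.exp_sub, Real.exp_log hq0, ramW]
  rw [show a * (q / Real.exp y) = a * q / Real.exp y by ring,
    show b / (q / Real.exp y) = b / q * Real.exp y by field_simp,
    show q / (q / Real.exp y) = Real.exp y by field_simp, mul_comm (qpi q (-Real.exp y)),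
    mul_comm (qpi q _) (qpi q _)]

lemma qpi_mul_ramMass_q (hq0 : 0 < q) (hq1 : q < 1) {b : ℝ} (hb : 0 ≤ b) (hbq : b ≤ q ^ 2) :
    qpi q q * ramMass q q b = qpi q b * ramMass q 0 b := by
  have hpow : ∀ n : ℕ, q * q ^ n ≤ q := fun n =>
    mul_le_of_le_one_right hq0.le (pow_le_one₀ hq0.le hq1.le)
  have hfin : ∀ n : ℕ, qp q q n * ramMass q q b = qp q b n * ramMass q (q * q ^ n) b := by
    intro n
    induction n with
    | zero => simp [qp]
    | succ n ih =>
      have h := ramMass_mul_q hq0 hq1 (a := q * q ^ n) (by positivity) (hpow n) hb hbq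
      have e : ∀ c, qp q c (n + 1) = qp q c n * (1 - c * q ^ n) := fun c => by
        simp [qp, Finset.prod_range_succ]
      rw [show q * q ^ n * b / q = b * q ^ n by field_simp, mul_assoc q (q ^ n) q, ← pow_succ] at h
      rw [e, e]
      linear_combination (1 - q * q ^ n) * ih + qp q b n * h
  have hz : Tendsto (fun n : ℕ => q * q ^ n) atTop (𝓝 0) := by
    simpa using (tendsto_pow_atTop_nhds_zero_of_lt_one hq0.le hq1).const_mul q
  have hlim : Tendsto (fun n : ℕ => ramMass q (q * q ^ n) b) atTop (𝓝 (ramMass q 0 b)) := by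
    refine tendsto_integral_of_dominated_convergence (fun y => 2 / q * (1 + y ^ 2)⁻¹)
      (fun n => ((measurable_ramW hq0 hq1 _ b).comp Real.measurable_exp).aestronglyMeasurable)
      (integrable_inv_one_add_sq.const_mul _)
      (fun n => Eventually.of_forall
        (norm_ramW_le hq0 hq1 (by positivity) (hpow n) hb hbq))
      (Eventually.of_forall fun y => ?_)
    have h := tendsto_qpi_of_tendsto_zero hq0 hq1
      (u := fun n => -(q * q ^ n * Real.exp y)) (by simpa using (hz.mul_const (Real.exp y)).neg)
    have h2 := (h.mul_const (qpi q (-(b / Real.exp y)))).div_const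
      (qpi q (-Real.exp y) * qpi q (-(q / Real.exp y)))
    simpa [ramW, qpi_zero] using h2
  exact tendsto_nhds_unique ((tendsto_qp_qpi hq0 hq1 q).mul_const _)
    (((tendsto_qp_qpi hq0 hq1 b).mul hlim).congr fun n => (hfin n).symm)

lemma ramMass_q_qsq (hq0 : 0 < q) (hq1 : q < 1) :
    ramMass q q (q ^ 2) = Real.log (1 / q) / (1 - q) := by
  have hq' : 0 < 1 - q := by linarith
  have hderiv : ∀ y : ℝ, HasDerivAt
      (fun y => Real.log (1 - (1 - q) / (1 + Real.exp y)) / (1 - q))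
      (ramW q q (q ^ 2) (Real.exp y)) y := by
    intro y
    have hu := Real.exp_pos y
    have hpos : 0 < 1 - (1 - q) / (1 + Real.exp y) := by
      rw [sub_pos, div_lt_one (by positivity)]; linarith
    have h1 : HasDerivAt (fun y => 1 + Real.exp y) (Real.exp y) y :=
      (Real.hasDerivAt_exp y).const_add 1
    have h2 := ((((hasDerivAt_const y (1 - q)).div h1 (by positivity)).const_sub 1).log
      hpos.ne').div_const (1 - q)
    refine HasDerivAt.congr_deriv (f' := -((0 * (1 + Real.exp y) - (1 - q) * Real.exp y) /
      (1 + Real.exp y) ^ 2) / (1 - (1 - q) / (1 + Real.exp y)) / (1 - q)) h2 ?_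
    rw [ramW_q_qsq hq0 hq1 hu]
    have : (1 : ℝ) - (1 - q) / (1 + Real.exp y) = (Real.exp y + q) / (1 + Real.exp y) := by
      field_simp; ring
    rw [this]
    field_simp
    ring
  have hint := integrable_ramW hq0 hq1 hq0.le le_rfl (sq_nonneg q) le_rfl
  have htop : Tendsto (fun y => Real.log (1 - (1 - q) / (1 + Real.exp y)) / (1 - q)) atTop
      (𝓝 (Real.log (1 - 0) / (1 - q))) := by
    refine (Tendsto.log (Tendsto.const_sub 1 ?_) (by norm_num)).div_const _
    exact tendsto_const_nhds.div_atTop (tendsto_atTop_add_const_left _ 1 Real.tendsto_exp_atTop)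
  have hbot : Tendsto (fun y => Real.log (1 - (1 - q) / (1 + Real.exp y)) / (1 - q)) atBot
      (𝓝 (Real.log (1 - (1 - q) / (1 + 0)) / (1 - q))) := by
    refine (Tendsto.log (Tendsto.const_sub 1 ?_) (by simp [hq0.ne'])).div_const _
    exact tendsto_const_nhds.div (Real.tendsto_exp_atBot.const_add 1) (by norm_num)
  rw [ramMass, integral_of_hasDerivAt_of_tendsto hderiv hint hbot htop]
  simp
  ring

lemma ramMass_zero_zero (hq0 : 0 < q) (hq1 : q < 1) :
    ramMass q 0 0 = qpi q q * Real.log (1 / q) := by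
  have hP := qpi_self_ne_zero hq0 hq1
  have h1 := qpi_mul_ramMass_q hq0 hq1 (sq_nonneg q) le_rfl
  have h2 := qpi_mul_ramMass_q hq0 hq1 le_rfl (sq_nonneg q)
  have h3 := ramMass_symm hq0 0 (q ^ 2)
  rw [zero_mul, show q ^ 2 / q = q by field_simp] at h3
  rw [qpi_zero, one_mul] at h2
  have h4 := qpi_eq_mul hq0 hq1 q
  rw [← sq] at h4
  have hq' : 1 - q ≠ 0 := by linarith
  rw [h3, ramMass_q_qsq hq0 hq1] at h1
  have h5 : qpi q (q ^ 2) ≠ 0 := fun h => hP (by rw [h4, h, mul_zero])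
  rw [← h2]
  have h6 : qpi q (q ^ 2) * ramMass q q 0 = qpi q (q ^ 2) * Real.log (1 / q) := by
    rw [← h1]
    nth_rewrite 1 [h4]
    field_simp
  rw [mul_left_cancel₀ h5 h6]

lemma mass_zero (hq0 : 0 < q) (hq1 : q < 1) :
    mass q 0 0 0 = qpi q q * Real.log (1 / q) := by
  have i1 := integrable_exp_mul_ramW hq0 hq1 le_rfl (sq_nonneg q) le_rfl (sq_nonneg q)
  have i2 := integrable_ramW hq0 hq1 le_rfl hq0.le le_rfl (sq_nonneg q)
  have h := integral_exp_mul_ramW hq0 hq1 le_rfl (sq_nonneg q) le_rfl (sq_nonneg q)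
  simp only [zero_div, sub_zero, one_mul] at h
  have hc := Measure.integral_comp_mul_left
    (fun y => ramW q 0 0 (Real.exp y) + Real.exp y * ramW q 0 0 (Real.exp y)) 2
  rw [integral_add i2 i1, h, ← ramMass] at hc
  have hpt : ∀ y, wz q 0 0 0 (Real.exp y) = ramW q 0 0 (Real.exp (2 * y)) +
      Real.exp (2 * y) * ramW q 0 0 (Real.exp (2 * y)) := by
    intro y
    have hu := Real.exp_pos y
    have h1 := qpi_neg_pos hq0 hq1 (u := q * Real.exp y ^ 2) (by positivity)
    rw [two_mul, Real.exp_add, ← sq, wz, ramW, thetaDen, ladder,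
      qpi_eq_mul hq0 hq1 (-Real.exp y ^ 2),
      show -Real.exp y ^ 2 * q = -(q * Real.exp y ^ 2) by ring, sub_neg_eq_add]
    simp only [zero_mul, zero_div, neg_zero, qpi_zero]
    have h2 := qpi_neg_pos hq0 hq1 (u := q / Real.exp y ^ 2) (by positivity)
    generalize qpi q (-(q / Real.exp y ^ 2)) = D at h2 ⊢
    field_simp
  rw [mass, funext hpt, hc, ← ramMass_zero_zero hq0 hq1]
  norm_num
  ring

end NormalizingConstant

section MassEvaluation

variable {q : ℝ}

lemma mass_swap12 (q t1 t2 t3 : ℝ) : mass q t1 t2 t3 = mass q t2 t1 t3 := by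
  simp only [mass, wz_swap12 q t1 t2 t3]

lemma mass_swap23 (q t1 t2 t3 : ℝ) : mass q t1 t2 t3 = mass q t1 t3 t2 := by
  simp only [mass, wz_swap23 q t1 t2 t3]

/-- The product `(-t₁t₂/q, -t₁t₃/q, -t₂t₃/q;q)_∞`. -/
def pairProd (q t1 t2 t3 : ℝ) : ℝ :=
  qpi q (-(t1 * t2 / q)) * qpi q (-(t1 * t3 / q)) * qpi q (-(t2 * t3 / q))

lemma pairProd_pos (hq0 : 0 < q) (hq1 : q < 1) {t1 t2 t3 : ℝ} (h1 : 0 ≤ t1) (h2 : 0 ≤ t2)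
    (h3 : 0 ≤ t3) : 0 < pairProd q t1 t2 t3 := by
  have h := fun {v : ℝ} (hv : 0 ≤ v) => qpi_neg_pos hq0 hq1 hv
  exact mul_pos (mul_pos (h (by positivity)) (h (by positivity))) (h (by positivity))

lemma mass_div_pairProd_mul_q (hq0 : 0 < q) (hq1 : q < 1) {t1 t2 t3 : ℝ} (h1 : 0 ≤ t1)
    (h2 : 0 ≤ t2) (h3 : 0 ≤ t3) :
    mass q t1 t2 t3 / pairProd q t1 t2 t3 =
      mass q (t1 * q) t2 t3 / pairProd q (t1 * q) t2 t3 := by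
  have hm := mass_div hq0 hq1 (t1 * q) t2 t3
  rw [mul_div_cancel_right₀ _ hq0.ne'] at hm
  have hp : pairProd q t1 t2 t3 =
      (1 + t1 * t2 / q) * (1 + t1 * t3 / q) * pairProd q (t1 * q) t2 t3 := by
    rw [pairProd, qpi_eq_mul hq0 hq1 (-(t1 * t2 / q)), qpi_eq_mul hq0 hq1 (-(t1 * t3 / q)),
      pairProd, show -(t1 * t2 / q) * q = -(t1 * q * t2 / q) by ring,
      show -(t1 * t3 / q) * q = -(t1 * q * t3 / q) by ring]
    ring
  have hpos := pairProd_pos hq0 hq1 (mul_nonneg h1 hq0.le) h2 h3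
  rw [hm, hp, show t1 * q * t2 / q ^ 2 = t1 * t2 / q by field_simp,
    show t1 * q * t3 / q ^ 2 = t1 * t3 / q by field_simp]
  field_simp

lemma pairProd_swap12 (q t1 t2 t3 : ℝ) : pairProd q t1 t2 t3 = pairProd q t2 t1 t3 := by
  simp only [pairProd, mul_comm t2 t1]; ring

lemma pairProd_swap23 (q t1 t2 t3 : ℝ) : pairProd q t1 t2 t3 = pairProd q t1 t3 t2 := by
  simp only [pairProd, mul_comm t3 t2]; ring

lemma mass_div_pairProd_mul_q_all (hq0 : 0 < q) (hq1 : q < 1) {t1 t2 t3 : ℝ} (h1 : 0 ≤ t1)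
    (h2 : 0 ≤ t2) (h3 : 0 ≤ t3) :
    mass q t1 t2 t3 / pairProd q t1 t2 t3 =
      mass q (t1 * q) (t2 * q) (t3 * q) / pairProd q (t1 * q) (t2 * q) (t3 * q) := by
  have g1 := mul_nonneg h1 hq0.le
  have g2 := mul_nonneg h2 hq0.le
  rw [mass_div_pairProd_mul_q hq0 hq1 h1 h2 h3, mass_swap12, pairProd_swap12,
    mass_div_pairProd_mul_q hq0 hq1 h2 g1 h3, mass_swap12, pairProd_swap12, mass_swap23,
    pairProd_swap23, mass_swap12, pairProd_swap12, mass_div_pairProd_mul_q hq0 hq1 h3 g1 g2,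
    mass_swap12, pairProd_swap12, mass_swap23, pairProd_swap23]

/-- The evaluation of the total mass. -/
lemma mass_eq (hq0 : 0 < q) (hq1 : q < 1) {t1 t2 t3 : ℝ} (h1 : 0 ≤ t1)
    (h2 : 0 ≤ t2) (h3 : 0 ≤ t3) :
    mass q t1 t2 t3 = qpi q q * Real.log (1 / q) * pairProd q t1 t2 t3 := by
  have hfin : ∀ n : ℕ, mass q t1 t2 t3 / pairProd q t1 t2 t3 =
      mass q (t1 * q ^ n) (t2 * q ^ n) (t3 * q ^ n) /
        pairProd q (t1 * q ^ n) (t2 * q ^ n) (t3 * q ^ n) := by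
    intro n
    induction n with
    | zero => simp
    | succ n ih =>
      rw [ih, mass_div_pairProd_mul_q_all hq0 hq1 (by positivity) (by positivity) (by positivity)]
      simp only [pow_succ, mul_assoc]
  have hpow : Tendsto (fun n : ℕ => q ^ n) atTop (𝓝 0) :=
    tendsto_pow_atTop_nhds_zero_of_lt_one hq0.le hq1
  have hz : ∀ t : ℝ, Tendsto (fun n : ℕ => t * q ^ n) atTop (𝓝 0) := fun t => by
    simpa using hpow.const_mul t
  have hpair : ∀ s t : ℝ, Tendsto (fun n : ℕ => qpi q (-(s * q ^ n * (t * q ^ n) / q))) atTop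
      (𝓝 1) := fun s t => tendsto_qpi_of_tendsto_zero hq0 hq1 (by
        simpa using (((hz s).mul (hz t)).div_const q).neg)
  have hpp : Tendsto (fun n : ℕ => pairProd q (t1 * q ^ n) (t2 * q ^ n) (t3 * q ^ n)) atTop
      (𝓝 1) := by
    simpa [pairProd] using ((hpair t1 t2).mul (hpair t1 t3)).mul (hpair t2 t3)
  have hlim : Tendsto (fun n : ℕ => mass q (t1 * q ^ n) (t2 * q ^ n) (t3 * q ^ n)) atTop
      (𝓝 (mass q 0 0 0)) := by
    set T := max t1 (max t2 t3)
    have hT : ∀ t, 0 ≤ t → t ≤ T → ∀ n : ℕ, |t * q ^ n| ≤ T := fun t ht htT n => by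
      rw [abs_of_nonneg (by positivity)]
      exact (mul_le_of_le_one_right ht (pow_le_one₀ hq0.le hq1.le)).trans htT
    obtain ⟨B, hB, hdom⟩ := exists_integrable_dominating hq0 hq1
      (T := T) (h1.trans (le_max_left _ _)) 0 1
    refine tendsto_integral_of_dominated_convergence B
      (fun n => ((measurable_wz hq0 hq1 _ _ _).comp Real.measurable_exp).aestronglyMeasurable)
      hB (fun n => Eventually.of_forall fun y => ?_) (Eventually.of_forall fun y => ?_)
    · simpa using hdom _ _ _ (hT t1 h1 (by simp [T]) n) (hT t2 h2 (by simp [T]) n)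
        (hT t3 h3 (by simp [T]) n) (fun _ => 1) (by simp) y
    · have hl : ∀ t : ℝ, Tendsto (fun n : ℕ => ladder q (t * q ^ n) (Real.exp y)) atTop
          (𝓝 (1 * 1)) := fun t =>
        (tendsto_qpi_of_tendsto_zero hq0 hq1
          (by simpa using ((hz t).mul_const (Real.exp y)).neg)).mul
        (tendsto_qpi_of_tendsto_zero hq0 hq1
          (by simpa using (hz t).div_const (Real.exp y)))
      have := (((hl t1).mul (hl t2)).mul (hl t3)).div_const (thetaDen q (Real.exp y))
      simpa [wz, ladder, qpi_zero] using this
  have hconst := tendsto_nhds_unique (tendsto_const_nhds.congr hfin) (hlim.div hpp one_ne_zero)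
  rw [mass_zero hq0 hq1, div_one, div_eq_iff (pairProd_pos hq0 hq1 h1 h2 h3).ne'] at hconst
  exact hconst

end MassEvaluation

section Substitution

variable {q : ℝ}

lemma zx_sinh (y : ℝ) : zx (Real.sinh y) = Real.exp y := by
  rw [zx, show Real.sinh y ^ 2 + 1 = Real.cosh y ^ 2 by rw [Real.cosh_sq],
    Real.sqrt_sq (Real.cosh_pos y).le, Real.sinh_add_cosh]

lemma cosh_mul_vW_sinh (hq0 : 0 < q) (hq1 : q < 1) {t1 t2 t3 : ℝ} (h1 : 0 ≤ t1) (h2 : 0 ≤ t2)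
    (h3 : 0 ≤ t3) (y : ℝ) :
    Real.cosh y * vW q t1 t2 t3 (Real.sinh y) =
      wz q t1 t2 t3 (Real.exp y) / mass q t1 t2 t3 := by
  have hu := Real.exp_pos y
  have hc : 2 * Real.exp y * Real.cosh y = 1 + Real.exp y ^ 2 := by
    rw [Real.cosh_eq, Real.exp_neg]
    field_simp
    ring
  rw [mass_eq hq0 hq1 h1 h2 h3, vW, zx_sinh, wz, thetaDen, ladder, ladder, ladder, pairProd,
    qpi_eq_mul hq0 hq1 (-Real.exp y ^ 2),
    show -Real.exp y ^ 2 * q = -(q * Real.exp y ^ 2) by ring, sub_neg_eq_add, ← hc]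
  simp only [neg_mul, neg_div]
  have hch := Real.cosh_pos y
  have hr : ∀ a b c d e f : ℝ, Real.cosh y * (2 * Real.exp y * a /
      (b * (2 * Real.exp y * Real.cosh y * c) * d * e * f)) = a / (c * d) / (b * e * f) := by
    intro a b c d e f
    field_simp
  simp only [mul_assoc] at hr ⊢
  exact hr ..

lemma integral_mul_vW (hq0 : 0 < q) (hq1 : q < 1) {t1 t2 t3 : ℝ} (h1 : 0 ≤ t1) (h2 : 0 ≤ t2)
    (h3 : 0 ≤ t3) (f : ℝ → ℝ) :
    ∫ x, f x * vW q t1 t2 t3 x =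
      (∫ y, f (Real.sinh y) * wz q t1 t2 t3 (Real.exp y)) / mass q t1 t2 t3 := by
  have h := integral_image_eq_integral_abs_deriv_smul (s := Set.univ) MeasurableSet.univ
    (fun y _ => (Real.hasDerivAt_sinh y).hasDerivWithinAt) Real.sinh_injective.injOn
    (fun x => f x * vW q t1 t2 t3 x)
  rw [Set.image_univ, Real.sinh_surjective.range_eq, setIntegral_univ, setIntegral_univ] at h
  rw [h, ← integral_div]
  refine integral_congr_ae (Eventually.of_forall fun y => ?_)
  simp only [smul_eq_mul]
  rw [abs_of_pos (Real.cosh_pos y), mul_left_comm, cosh_mul_vW_sinh hq0 hq1 h1 h2 h3, mul_div_assoc]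

lemma integrable_mul_vW (hq0 : 0 < q) (hq1 : q < 1) {t1 t2 t3 : ℝ} (h1 : 0 ≤ t1) (h2 : 0 ≤ t2)
    (h3 : 0 ≤ t3) {f : ℝ → ℝ}
    (hf : Integrable fun y => f (Real.sinh y) * wz q t1 t2 t3 (Real.exp y)) :
    Integrable fun x => f x * vW q t1 t2 t3 x := by
  have h := integrableOn_image_iff_integrableOn_abs_deriv_smul (s := Set.univ) MeasurableSet.univ
    (fun y _ => (Real.hasDerivAt_sinh y).hasDerivWithinAt) Real.sinh_injective.injOn
    (fun x => f x * vW q t1 t2 t3 x)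
  rw [Set.image_univ, Real.sinh_surjective.range_eq, integrableOn_univ, integrableOn_univ] at h
  refine h.2 ((hf.div_const (mass q t1 t2 t3)).congr (Eventually.of_forall fun y => ?_))
  simp only [smul_eq_mul]
  rw [abs_of_pos (Real.cosh_pos y), mul_left_comm, cosh_mul_vW_sinh hq0 hq1 h1 h2 h3, mul_div_assoc]

lemma abs_sinh_le_exp_abs (y : ℝ) : |Real.sinh y| ≤ Real.exp |y| := by
  rw [Real.abs_sinh, Real.sinh_eq]
  have := Real.exp_pos |y|
  have := Real.exp_pos (-|y|)
  linarith

lemma integrable_pow_sinh_mul_wz (hq0 : 0 < q) (hq1 : q < 1) (t1 t2 t3 : ℝ) (n : ℕ) :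
    Integrable fun y => Real.sinh y ^ n * wz q t1 t2 t3 (Real.exp y) :=
  integrable_mul_wz hq0 hq1 t1 t2 t3 (Real.measurable_sinh.pow_const n) 1 n fun y => by
    rw [abs_pow, one_mul]
    exact pow_le_pow_left₀ (abs_nonneg _) (abs_sinh_le_exp_abs y) n

lemma integrable_moment (hq0 : 0 < q) (hq1 : q < 1) {t1 t2 t3 : ℝ} (h1 : 0 ≤ t1) (h2 : 0 ≤ t2)
    (h3 : 0 ≤ t3) (n : ℕ) : Integrable fun x : ℝ => |x| ^ n * |vW q t1 t2 t3 x| := by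
  refine (integrable_mul_vW hq0 hq1 h1 h2 h3 (f := fun x => x ^ n)
    (integrable_pow_sinh_mul_wz hq0 hq1 t1 t2 t3 n)).abs.congr (Eventually.of_forall fun x => ?_)
  simp only [abs_mul, abs_pow]

lemma integrable_eval_mul_wz (hq0 : 0 < q) (hq1 : q < 1) (t1 t2 t3 : ℝ) (p : Polynomial ℝ) :
    Integrable fun y => p.eval (Real.sinh y) * wz q t1 t2 t3 (Real.exp y) := by
  induction p using Polynomial.induction_on' with
  | add p r hp hr =>
    simp only [Polynomial.eval_add, add_mul]
    exact hp.add hr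
  | monomial n a =>
    simpa only [Polynomial.eval_monomial, mul_assoc] using
      (integrable_pow_sinh_mul_wz hq0 hq1 t1 t2 t3 n).const_mul a

/-- Integration of polynomials against the normalized weight. -/
def weightFunctional (hq0 : 0 < q) (hq1 : q < 1) (t1 t2 t3 : ℝ) : Polynomial ℝ →ₗ[ℝ] ℝ where
  toFun p := (∫ y, p.eval (Real.sinh y) * wz q t1 t2 t3 (Real.exp y)) / mass q t1 t2 t3
  map_add' p r := by
    simp only [Polynomial.eval_add, add_mul]
    rw [integral_add (integrable_eval_mul_wz hq0 hq1 t1 t2 t3 p)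
      (integrable_eval_mul_wz hq0 hq1 t1 t2 t3 r), add_div]
  map_smul' c p := by
    simp only [Polynomial.eval_smul, smul_eq_mul, mul_assoc, integral_const_mul, RingHom.id_apply,
      mul_div_assoc]

end Substitution

section TerminatingSum

variable {q : ℝ}

lemma qp_succ (q a : ℝ) (n : ℕ) : qp q a (n + 1) = qp q a n * (1 - a * q ^ n) := by
  rw [qp, Finset.prod_range_succ, ← qp]

lemma qp_succ' (q a : ℝ) (n : ℕ) : qp q a (n + 1) = (1 - a) * qp q (a * q) n := by
  rw [qp, Finset.prod_range_succ', qp, mul_comm, pow_zero, mul_one]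
  simp only [pow_succ', mul_assoc]

lemma qp_add (q a : ℝ) (k m : ℕ) : qp q a (k + m) = qp q a k * qp q (a * q ^ k) m := by
  simp only [qp, Finset.prod_range_add, pow_add, mul_assoc]

lemma qp_pos (hq0 : 0 < q) {a : ℝ} (ha : a ≤ 0) (n : ℕ) : 0 < qp q a n :=
  Finset.prod_pos fun j _ => by
    have := mul_nonpos_of_nonpos_of_nonneg ha (pow_pos hq0 j).le
    linarith

lemma qp_self_pos (hq0 : 0 < q) (hq1 : q < 1) (n : ℕ) : 0 < qp q q n :=
  Finset.prod_pos fun j _ => by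
    rw [← pow_succ', sub_pos]
    exact pow_lt_one₀ hq0.le hq1 j.succ_ne_zero

/-- The coefficient `(q⁻ⁿ;q)_k q^{nk} / (q;q)_k`. -/
def qcoef (q : ℝ) (n k : ℕ) : ℝ := qp q (q ^ n)⁻¹ k * (q ^ n) ^ k / qp q q k

lemma qcoef_succ_succ (hq0 : 0 < q) (hq1 : q < 1) (n k : ℕ) :
    qcoef q (n + 1) (k + 1) = q ^ (k + 1) * qcoef q n (k + 1) - q ^ k * qcoef q n k := by
  have h := qp_self_pos hq0 hq1 (k + 1)
  have hk := qp_self_pos hq0 hq1 k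
  have e : (q ^ (n + 1))⁻¹ * q = (q ^ n)⁻¹ := by
    rw [pow_succ]
    field_simp
  rw [qcoef, qcoef, qcoef, qp_succ' q (q ^ (n + 1))⁻¹, e, qp_succ q (q ^ n)⁻¹]
  rw [qp_succ] at h ⊢
  have h2 : 0 < 1 - q * q ^ k := pos_of_mul_pos_right h hk.le
  field_simp
  ring

lemma qcoef_self_succ (hq0 : 0 < q) (n : ℕ) : qcoef q n (n + 1) = 0 := by
  rw [qcoef, qp_succ, inv_mul_cancel₀ (pow_pos hq0 n).ne', sub_self, mul_zero, zero_mul, zero_div]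

lemma sum_qcoef_succ (hq0 : 0 < q) (hq1 : q < 1) (n : ℕ) (g : ℕ → ℝ) :
    ∑ k ∈ range (n + 2), qcoef q (n + 1) k * g k =
      ∑ k ∈ range (n + 1), qcoef q n k * (q ^ k * (g k - g (k + 1))) := by
  have h : ∑ k ∈ range (n + 1), qcoef q n k * (q ^ k * g k) =
      ∑ k ∈ range (n + 1), qcoef q n (k + 1) * (q ^ (k + 1) * g (k + 1)) + g 0 := by
    have := Finset.sum_range_succ' (fun k => qcoef q n k * (q ^ k * g k)) (n + 1)
    rw [Finset.sum_range_succ, qcoef_self_succ hq0, zero_mul, add_zero] at this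
    rw [this]
    simp [qcoef, qp]
  simp only [mul_sub, Finset.sum_sub_distrib]
  rw [h, Finset.sum_range_succ', add_sub_right_comm, ← Finset.sum_sub_distrib]
  congr 1
  · refine Finset.sum_congr rfl fun k _ => ?_
    rw [qcoef_succ_succ hq0 hq1]
    ring
  · simp [qcoef, qp]

lemma pow_mul_sub_shift (hq0 : 0 < q) (b : ℝ) (m k : ℕ) :
    q ^ k * ((q ^ (k * (m + 1)))⁻¹ * qp q (b * q ^ k) (m + 1) -
      (q ^ ((k + 1) * (m + 1)))⁻¹ * qp q (b * q ^ (k + 1)) (m + 1)) =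
      (1 - (q ^ (m + 1))⁻¹) * ((q ^ (k * m))⁻¹ * qp q (b * q * q ^ k) m) := by
  rw [qp_succ', qp_succ, show b * q ^ k * q = b * q * q ^ k by ring,
    show b * q ^ (k + 1) = b * q * q ^ k by ring]
  have : q ≠ 0 := hq0.ne'
  field_simp
  ring

lemma sum_qcoef_of_lt (hq0 : 0 < q) (hq1 : q < 1) {m n : ℕ} (h : m < n) (b : ℝ) :
    ∑ k ∈ range (n + 1), qcoef q n k * ((q ^ (k * m))⁻¹ * qp q (b * q ^ k) m) = 0 := by
  induction n generalizing m b with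
  | zero => simp at h
  | succ n ih =>
    rw [sum_qcoef_succ hq0 hq1]
    cases m with
    | zero => simp [qp]
    | succ m =>
      simp only [pow_mul_sub_shift hq0, mul_left_comm (qcoef q n _) (1 - (q ^ (m + 1))⁻¹)]
      rw [← Finset.mul_sum, ih (by lia), mul_zero]

lemma qp_inv_pow_succ (hq0 : 0 < q) (n : ℕ) :
    qp q (q ^ (n + 1))⁻¹ (n + 1) = (1 - (q ^ (n + 1))⁻¹) * qp q (q ^ n)⁻¹ n := by
  rw [qp_succ', pow_succ, mul_inv, mul_assoc, inv_mul_cancel₀ hq0.ne', mul_one]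

lemma sum_qcoef_self (hq0 : 0 < q) (hq1 : q < 1) (n : ℕ) (b : ℝ) :
    ∑ k ∈ range (n + 1), qcoef q n k * ((q ^ (k * n))⁻¹ * qp q (b * q ^ k) n) =
      qp q (q ^ n)⁻¹ n := by
  induction n generalizing b with
  | zero => simp [qp, qcoef]
  | succ n ih =>
    rw [sum_qcoef_succ hq0 hq1]
    simp only [pow_mul_sub_shift hq0, mul_left_comm (qcoef q n _) (1 - (q ^ (n + 1))⁻¹)]
    rw [← Finset.mul_sum, ih, qp_inv_pow_succ hq0]

lemma qp_inv_pow_sq (hq0 : 0 < q) (n : ℕ) :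
    qp q (q ^ n)⁻¹ n ^ 2 * (q ^ n) ^ n * q ^ n = qp q q n ^ 2 := by
  induction n with
  | zero => simp [qp]
  | succ n ih =>
    rw [qp_inv_pow_succ hq0, qp_succ, mul_pow _ _ 2, mul_pow _ _ 2, ← ih]
    have : q ≠ 0 := hq0.ne'
    field_simp
    ring

end TerminatingSum

section PolynomialBasis

open Polynomial

variable {q : ℝ}

/-- The polynomial equal to `(-q/(tz), qz/t;q)_k` at `x = (z - 1/z)/2`. -/
def basisPoly (q t : ℝ) (k : ℕ) : ℝ[X] :=
  ∏ i ∈ range k, (C (1 - (q ^ (i + 1) / t) ^ 2) - C (2 * (q ^ (i + 1) / t)) * X)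

lemma basisPoly_succ (q t : ℝ) (k : ℕ) : basisPoly q t (k + 1) =
    basisPoly q t k * (C (1 - (q ^ (k + 1) / t) ^ 2) - C (2 * (q ^ (k + 1) / t)) * X) :=
  Finset.prod_range_succ _ _

lemma zx_pos (x : ℝ) : 0 < zx x := by
  obtain ⟨y, rfl⟩ := Real.sinh_surjective x
  rw [zx_sinh]
  exact Real.exp_pos y

lemma two_mul_eq_zx_sub (x : ℝ) : 2 * x = zx x - (zx x)⁻¹ := by
  obtain ⟨y, rfl⟩ := Real.sinh_surjective x
  rw [zx_sinh, Real.sinh_eq, Real.exp_neg]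
  ring

lemma eval_basisPoly (q : ℝ) {t : ℝ} (ht : t ≠ 0) (k : ℕ) (x : ℝ) :
    (basisPoly q t k).eval x = qp q (-q / (t * zx x)) k * qp q (q * zx x / t) k := by
  rw [basisPoly, eval_prod, qp, qp, ← Finset.prod_mul_distrib]
  refine Finset.prod_congr rfl fun i _ => ?_
  have hz := zx_pos x
  simp only [eval_sub, eval_mul, eval_C, eval_X]
  rw [mul_right_comm, two_mul_eq_zx_sub]
  field_simp
  ring

lemma eval_basisPoly_succ_mul_ladder (hq0 : 0 < q) (hq1 : q < 1) {t : ℝ} (ht : t ≠ 0) (k : ℕ)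
    (y : ℝ) :
    (C (1 - (q ^ (k + 1) / t) ^ 2) - C (2 * (q ^ (k + 1) / t)) * X : ℝ[X]).eval (Real.sinh y) *
      ladder q (t / q ^ k) (Real.exp y) =
      -(q ^ (k + 1) / t) ^ 2 * ladder q (t / q ^ (k + 1)) (Real.exp y) := by
  have hz := Real.exp_pos y
  rw [pow_succ q k, ← div_div t, ladder_div hq0 hq1]
  simp only [eval_sub, eval_mul, eval_C, eval_X]
  rw [mul_right_comm 2, two_mul_eq_zx_sub, zx_sinh]
  field_simp
  ring

lemma eval_basisPoly_mul_ladder (hq0 : 0 < q) (hq1 : q < 1) {t : ℝ} (ht : t ≠ 0) (k : ℕ)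
    (y : ℝ) :
    (basisPoly q t k).eval (Real.sinh y) * ladder q t (Real.exp y) =
      (∏ i ∈ range k, -(q ^ (i + 1) / t) ^ 2) * ladder q (t / q ^ k) (Real.exp y) := by
  induction k with
  | zero => simp [basisPoly]
  | succ k ih =>
    rw [basisPoly_succ, eval_mul, mul_right_comm, ih, mul_right_comm, Finset.prod_range_succ,
      mul_assoc _ (-(_ ^ 2)), ← eval_basisPoly_succ_mul_ladder hq0 hq1 ht k y]
    ring

lemma weightFunctional_basis_mul_basis (hq0 : 0 < q) (hq1 : q < 1) {t1 t2 : ℝ} (t3 : ℝ)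
    (h1 : t1 ≠ 0) (h2 : t2 ≠ 0) (k m : ℕ) :
    weightFunctional hq0 hq1 t1 t2 t3 (basisPoly q t1 k * basisPoly q t2 m) =
      (∏ i ∈ range k, -(q ^ (i + 1) / t1) ^ 2) * (∏ i ∈ range m, -(q ^ (i + 1) / t2) ^ 2) *
        mass q (t1 / q ^ k) (t2 / q ^ m) t3 / mass q t1 t2 t3 := by
  simp only [weightFunctional, LinearMap.coe_mk, AddHom.coe_mk]
  rw [show mass q (t1 / q ^ k) (t2 / q ^ m) t3 =
    ∫ y, wz q (t1 / q ^ k) (t2 / q ^ m) t3 (Real.exp y) from rfl, ← integral_const_mul]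
  congr 2
  refine funext fun y => ?_
  have e1 := eval_basisPoly_mul_ladder hq0 hq1 h1 k y
  have e2 := eval_basisPoly_mul_ladder hq0 hq1 h2 m y
  rw [eval_mul, wz, wz, mul_div_assoc', mul_div_assoc']
  congr 1
  linear_combination
    (basisPoly q t2 m).eval (Real.sinh y) * ladder q t2 (Real.exp y) * ladder q t3 (Real.exp y) * e1
    + (∏ i ∈ range k, -(q ^ (i + 1) / t1) ^ 2) * ladder q (t1 / q ^ k) (Real.exp y) *
      ladder q t3 (Real.exp y) * e2

/-- The mixed moments of the weight. -/
lemma mixed_moment (hq0 : 0 < q) (hq1 : q < 1) {t1 t2 t3 : ℝ}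
    (h1 : 0 < t1) (h2 : 0 < t2) (h3 : 0 < t3) (k m : ℕ) :
    weightFunctional hq0 hq1 t1 t2 t3 (basisPoly q t1 k * basisPoly q t2 m) =
      qp q (-q ^ 2 / (t1 * t3)) k * qp q (-q ^ 2 / (t2 * t3)) m *
        qp q (-q ^ 2 / (t1 * t2)) (k + m) /
      ((-q ^ 2 / (t2 * t3)) ^ k * (-q ^ 2 / (t1 * t3)) ^ m * q ^ (k * m)) := by
  rw [weightFunctional_basis_mul_basis hq0 hq1 t3 h1.ne' h2.ne']
  have hM : mass q t1 t2 t3 ≠ 0 := by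
    rw [mass_eq hq0 hq1 h1.le h2.le h3.le]
    have := Real.log_pos (one_lt_one_div hq0 hq1)
    exact mul_ne_zero (mul_ne_zero (qpi_self_ne_zero hq0 hq1) this.ne')
      (pairProd_pos hq0 hq1 h1.le h2.le h3.le).ne'
  rw [div_eq_iff hM]
  have hneg : ∀ {s : ℝ}, 0 < s → -q ^ 2 / s ≠ 0 := fun hs =>
    div_ne_zero (neg_ne_zero.2 (pow_pos hq0 2).ne') hs.ne'
  induction k with
  | zero =>
    induction m with
    | zero => simp [qp]
    | succ m ih =>
      rw [pow_zero, div_one] at ih ⊢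
      have h := mass_div hq0 hq1 (t2 / q ^ m) t1 t3
      rw [div_div, ← pow_succ, mass_swap12, mass_swap12 q (t2 / q ^ m)] at h
      rw [h, Finset.prod_range_succ, ← add_assoc, qp_succ, qp_succ]
      have e : ∀ A B c d e M : ℝ, A * (B * c) * (d * e * M) = c * d * e * (A * B * M) := by
        intros; ring
      rw [e, ih, zero_add, pow_succ (-q ^ 2 / (t1 * t3)) m]
      generalize qp q _ _ = A, qp q _ _ = B, qp q _ _ = C, mass _ _ _ _ = M
      have hP : (-q ^ 2 / (t1 * t3)) ^ m ≠ 0 := pow_ne_zero _ (hneg (by positivity))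
      generalize (-q ^ 2 / (t1 * t3)) ^ m = P at hP ⊢
      field_simp
      ring
  | succ k ih =>
    have h := mass_div hq0 hq1 (t1 / q ^ k) (t2 / q ^ m) t3
    rw [div_div, ← pow_succ] at h
    rw [h, Finset.prod_range_succ, add_right_comm, qp_succ, qp_succ]
    have e : ∀ A B c d e M : ℝ, A * c * B * (d * e * M) = c * d * e * (A * B * M) := by
      intros; ring
    rw [e, ih, pow_succ (-q ^ 2 / (t2 * t3)) k]
    generalize qp q _ _ = A, qp q _ _ = B, qp q _ _ = C, mass _ _ _ _ = M
    have hP : (-q ^ 2 / (t2 * t3)) ^ k ≠ 0 := pow_ne_zero _ (hneg (by positivity))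
    have hR : (-q ^ 2 / (t1 * t3)) ^ m ≠ 0 := pow_ne_zero _ (hneg (by positivity))
    generalize (-q ^ 2 / (t2 * t3)) ^ k = P at hP ⊢
    generalize (-q ^ 2 / (t1 * t3)) ^ m = R at hR ⊢
    field_simp
    ring

end PolynomialBasis

section Orthogonality

open Polynomial

variable {q : ℝ}

/-- The leading factor of `Vp`. -/
def vPrefactor (q t1 t2 t3 : ℝ) (n : ℕ) : ℝ :=
  (t1 / q) ^ n * (qp q (-q ^ 2 / (t1 * t3)) n / qp q (-q ^ 2 / (t2 * t3)) n)

/-- The coefficients of `Vp` in the basis `basisPoly q t1`, up to the leading factor. -/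
def vCoef (q t1 t2 t3 : ℝ) (n k : ℕ) : ℝ :=
  qp q (q ^ n)⁻¹ k / (qp q q k * qp q (-q ^ 2 / (t1 * t3)) k * qp q (-q ^ 2 / (t1 * t2)) k) *
    (-q ^ (n + 2) / (t2 * t3)) ^ k

/-- `Vp` as a polynomial. -/
def vPoly (q t1 t2 t3 : ℝ) (n : ℕ) : ℝ[X] :=
  vPrefactor q t1 t2 t3 n • ∑ k ∈ range (n + 1), vCoef q t1 t2 t3 n k • basisPoly q t1 k

lemma eval_vPoly (q : ℝ) {t1 : ℝ} (ht : t1 ≠ 0) (t2 t3 : ℝ) (n : ℕ) (x : ℝ) :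
    (vPoly q t1 t2 t3 n).eval x = Vp q t1 t2 t3 n x := by
  rw [vPoly, eval_smul, eval_finsetSum, smul_eq_mul, vPrefactor, Vp]
  congr 1
  refine Finset.sum_congr rfl fun k _ => ?_
  rw [eval_smul, smul_eq_mul, eval_basisPoly q ht, vCoef, zpow_neg, zpow_natCast]
  ring

lemma map_mul_vPoly (L : ℝ[X] →ₗ[ℝ] ℝ) (V : ℝ[X]) (q t1 t2 t3 : ℝ) (n : ℕ) :
    L (V * vPoly q t1 t2 t3 n) = vPrefactor q t1 t2 t3 n *
      ∑ k ∈ range (n + 1), vCoef q t1 t2 t3 n k * L (V * basisPoly q t1 k) := by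
  simp only [vPoly, mul_smul_comm, map_smul, Finset.mul_sum, map_sum, smul_eq_mul]

lemma vCoef_mul_mixed_moment (hq0 : 0 < q) (hq1 : q < 1) {t1 t2 t3 : ℝ}
    (h1 : 0 < t1) (h2 : 0 < t2) (h3 : 0 < t3) (n k m : ℕ) :
    vCoef q t1 t2 t3 n k *
      weightFunctional hq0 hq1 t1 t2 t3 (basisPoly q t1 k * basisPoly q t2 m) =
      qp q (-q ^ 2 / (t2 * t3)) m / (-q ^ 2 / (t1 * t3)) ^ m *
        (qcoef q n k * ((q ^ (k * m))⁻¹ * qp q (-q ^ 2 / (t1 * t2) * q ^ k) m)) := by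
  have hneg : ∀ {s : ℝ}, 0 < s → -q ^ 2 / s < 0 := fun hs =>
    div_neg_of_neg_of_pos (neg_neg_of_pos (pow_pos hq0 2)) hs
  rw [mixed_moment hq0 hq1 h1 h2 h3, vCoef, qcoef, qp_add,
    show -q ^ (n + 2) / (t2 * t3) = q ^ n * (-q ^ 2 / (t2 * t3)) by ring, mul_pow]
  have ha := qp_pos hq0 (hneg (mul_pos h1 h3)).le k
  have hb := qp_pos hq0 (hneg (mul_pos h1 h2)).le k
  have hq := qp_self_pos hq0 hq1 k
  have hc := pow_ne_zero k (hneg (mul_pos h2 h3)).ne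
  have ha' := pow_ne_zero m (hneg (mul_pos h1 h3)).ne
  generalize (-q ^ 2 / (t2 * t3)) ^ k = P at hc ⊢
  generalize (-q ^ 2 / (t1 * t3)) ^ m = R at ha' ⊢
  generalize qp q (-q ^ 2 / (t1 * t3)) k = A at ha ⊢
  generalize qp q (-q ^ 2 / (t1 * t2)) k = B at hb ⊢
  field_simp

lemma weightFunctional_vPoly_mul_basis (hq0 : 0 < q) (hq1 : q < 1) {t1 t2 t3 : ℝ}
    (h1 : 0 < t1) (h2 : 0 < t2) (h3 : 0 < t3) (n m : ℕ) :
    weightFunctional hq0 hq1 t1 t2 t3 (vPoly q t1 t2 t3 n * basisPoly q t2 m) =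
      vPrefactor q t1 t2 t3 n * (qp q (-q ^ 2 / (t2 * t3)) m / (-q ^ 2 / (t1 * t3)) ^ m *
        ∑ k ∈ range (n + 1),
          qcoef q n k * ((q ^ (k * m))⁻¹ * qp q (-q ^ 2 / (t1 * t2) * q ^ k) m)) := by
  rw [vPoly, smul_mul_assoc, map_smul, Finset.sum_mul, map_sum, smul_eq_mul]
  rw [Finset.mul_sum (a := _ / _)]
  congr 1
  refine Finset.sum_congr rfl fun k _ => ?_
  rw [smul_mul_assoc, map_smul, smul_eq_mul, vCoef_mul_mixed_moment hq0 hq1 h1 h2 h3]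

lemma basisPoly_mul_zero (q t1 t2 : ℝ) (k : ℕ) :
    basisPoly q t1 k * basisPoly q t2 0 = basisPoly q t1 k := by
  rw [basisPoly.eq_1 q t2, Finset.range_zero, Finset.prod_empty, mul_one]

lemma basisPoly_succ_mul (hq0 : 0 < q) {t1 t2 : ℝ} (h2 : t2 ≠ 0)
    (k l : ℕ) : ∃ c : ℝ, basisPoly q t1 (k + 1) * basisPoly q t2 l =
      (t2 / t1 * q ^ k / q ^ l) • (basisPoly q t1 k * basisPoly q t2 (l + 1)) +
        c • (basisPoly q t1 k * basisPoly q t2 l) := by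
  refine ⟨1 - (q ^ (k + 1) / t1) ^ 2 - t2 / t1 * q ^ k / q ^ l * (1 - (q ^ (l + 1) / t2) ^ 2), ?_⟩
  have e : 2 * (q ^ (k + 1) / t1) = t2 / t1 * q ^ k / q ^ l * (2 * (q ^ (l + 1) / t2)) := by
    field_simp
    ring
  rw [basisPoly_succ, basisPoly_succ, e, smul_eq_C_mul, smul_eq_C_mul]
  simp only [map_sub, map_mul]
  ring

/-- Orthogonality to products of basis polynomials in both parameters. -/
lemma map_mul_basis_mul_basis (hq0 : 0 < q) {t1 t2 : ℝ} (h2 : t2 ≠ 0) (L : ℝ[X] →ₗ[ℝ] ℝ)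
    (V : ℝ[X]) {n : ℕ} (hV : ∀ m < n, L (V * basisPoly q t2 m) = 0) (k l : ℕ) :
    (k + l < n → L (V * (basisPoly q t1 k * basisPoly q t2 l)) = 0) ∧
    (k + l = n → L (V * (basisPoly q t1 k * basisPoly q t2 l)) =
      (t2 / t1) ^ k / q ^ (k * l) * L (V * basisPoly q t2 n)) := by
  induction k generalizing l with
  | zero =>
    refine ⟨fun h => ?_, fun h => ?_⟩
    · simpa [basisPoly] using hV l (by lia)
    · obtain rfl : l = n := by lia
      simp [basisPoly]
  | succ k ih =>
    obtain ⟨c, hc⟩ := basisPoly_succ_mul (t1 := t1) hq0 h2 k l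
    rw [hc, mul_add, map_add, mul_smul_comm, mul_smul_comm, map_smul, map_smul]
    refine ⟨fun h => ?_, fun h => ?_⟩
    · rw [(ih (l + 1)).1 (by lia), (ih l).1 (by lia), smul_zero, smul_zero, add_zero]
    · rw [(ih (l + 1)).2 (by lia), (ih l).1 (by lia), smul_zero, add_zero, smul_eq_mul]
      field_simp
      ring

lemma weightFunctional_vPoly_mul_basis_of_lt (hq0 : 0 < q) (hq1 : q < 1) {t1 t2 t3 : ℝ}
    (h1 : 0 < t1) (h2 : 0 < t2) (h3 : 0 < t3) {n m : ℕ} (h : m < n) :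
    weightFunctional hq0 hq1 t1 t2 t3 (vPoly q t1 t2 t3 n * basisPoly q t2 m) = 0 := by
  rw [weightFunctional_vPoly_mul_basis hq0 hq1 h1 h2 h3, sum_qcoef_of_lt hq0 hq1 h, mul_zero,
    mul_zero]

lemma weightFunctional_vPoly_mul_vPoly_of_lt (hq0 : 0 < q) (hq1 : q < 1) {t1 t2 t3 : ℝ}
    (h1 : 0 < t1) (h2 : 0 < t2) (h3 : 0 < t3) {n m : ℕ} (h : m < n) :
    weightFunctional hq0 hq1 t1 t2 t3 (vPoly q t1 t2 t3 n * vPoly q t1 t2 t3 m) = 0 := by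
  rw [map_mul_vPoly, Finset.sum_eq_zero, mul_zero]
  intro k hk
  have := (map_mul_basis_mul_basis (t1 := t1) hq0 h2.ne' (weightFunctional hq0 hq1 t1 t2 t3)
    (vPoly q t1 t2 t3 n)
    (fun m hm => weightFunctional_vPoly_mul_basis_of_lt hq0 hq1 h1 h2 h3 hm) k 0).1
    (by have := Finset.mem_range.1 hk; lia)
  rw [basisPoly_mul_zero] at this
  rw [this, mul_zero]

lemma weightFunctional_vPoly_mul_self (hq0 : 0 < q) (hq1 : q < 1) {t1 t2 t3 : ℝ}
    (h1 : 0 < t1) (h2 : 0 < t2) (h3 : 0 < t3) (n : ℕ) :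
    weightFunctional hq0 hq1 t1 t2 t3 (vPoly q t1 t2 t3 n * vPoly q t1 t2 t3 n) =
      qp q q n * qp q (-q ^ 2 / (t1 * t3)) n /
        (qp q (-q ^ 2 / (t1 * t2)) n * qp q (-q ^ 2 / (t2 * t3)) n) * (t1 ^ 2 / q ^ 3) ^ n := by
  have hV := fun m hm => weightFunctional_vPoly_mul_basis_of_lt hq0 hq1 h1 h2 h3
    (n := n) (m := m) hm
  have hB := map_mul_basis_mul_basis (t1 := t1) hq0 h2.ne' (weightFunctional hq0 hq1 t1 t2 t3)
    (vPoly q t1 t2 t3 n) hV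
  have hn := (hB n 0).2 rfl
  rw [basisPoly_mul_zero, weightFunctional_vPoly_mul_basis hq0 hq1 h1 h2 h3,
    sum_qcoef_self hq0 hq1] at hn
  rw [map_mul_vPoly, Finset.sum_eq_single n]
  rotate_left
  · intro k hk hkn
    have := (hB k 0).1 (by have := Finset.mem_range.1 hk; lia)
    rw [← basisPoly_mul_zero q t1 t2 k, this, mul_zero]
  · simp
  rw [hn, vPrefactor, vCoef]
  have hneg : ∀ {s : ℝ}, 0 < s → -q ^ 2 / s < 0 := fun hs =>
    div_neg_of_neg_of_pos (neg_neg_of_pos (pow_pos hq0 2)) hs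
  have ha := qp_pos hq0 (hneg (mul_pos h1 h3)).le n
  have hb := qp_pos hq0 (hneg (mul_pos h1 h2)).le n
  have hc := qp_pos hq0 (hneg (mul_pos h2 h3)).le n
  have hq := qp_self_pos hq0 hq1 n
  have hE := qp_inv_pow_sq hq0 n
  have hpow : (-q ^ (n + 2) / (t2 * t3)) ^ n =
      (q ^ n) ^ n * (t1 / t2) ^ n * (-q ^ 2 / (t1 * t3)) ^ n := by
    rw [← mul_pow, ← mul_pow]
    congr 1
    field_simp
    ring
  have ha' := pow_ne_zero n (hneg (mul_pos h1 h3)).ne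
  rw [hpow]
  generalize (-q ^ 2 / (t1 * t3)) ^ n = R at ha' ⊢
  generalize qp q (-q ^ 2 / (t1 * t3)) n = A at ha ⊢
  generalize qp q (-q ^ 2 / (t1 * t2)) n = B at hb ⊢
  generalize qp q (-q ^ 2 / (t2 * t3)) n = C at hc ⊢
  generalize qp q (q ^ n)⁻¹ n = D at hE ⊢
  generalize qp q q n = Q at hE hq ⊢
  rw [← pow_mul] at hE ⊢
  simp only [div_pow, mul_zero, pow_zero, ← pow_mul, mul_comm 3 n]
  rw [pow_mul q n 3]
  field_simp
  linear_combination t1 ^ (n * 2) * hE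

lemma integral_Vp_mul_Vp (hq0 : 0 < q) (hq1 : q < 1) {t1 t2 t3 : ℝ}
    (h1 : 0 < t1) (h2 : 0 < t2) (h3 : 0 < t3) (m n : ℕ) :
    ∫ x, Vp q t1 t2 t3 n x * Vp q t1 t2 t3 m x * vW q t1 t2 t3 x =
      weightFunctional hq0 hq1 t1 t2 t3 (vPoly q t1 t2 t3 n * vPoly q t1 t2 t3 m) := by
  rw [integral_mul_vW hq0 hq1 h1.le h2.le h3.le fun x => Vp q t1 t2 t3 n x * Vp q t1 t2 t3 m x]
  simp only [weightFunctional, LinearMap.coe_mk, AddHom.coe_mk, eval_mul,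
    eval_vPoly q h1.ne']

end Orthogonality

theorem infinite_family_signed_orthogonality
    (q : ℝ) (hq0 : 0 < q) (hq1 : q < 1) (t1 t2 t3 : ℝ)
    (ht1 : 0 < t1) (ht2 : 0 < t2) (ht3 : 0 < t3) :
    (∀ n : ℕ, Integrable (fun x : ℝ => |x| ^ n * |vW q t1 t2 t3 x|)) ∧
    ∀ m n : ℕ,
      ∫ x : ℝ, Vp q t1 t2 t3 n x * Vp q t1 t2 t3 m x * vW q t1 t2 t3 x =
        if m = n then
          qp q q n * qp q (-q ^ 2 / (t1 * t3)) n /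
            (qp q (-q ^ 2 / (t1 * t2)) n * qp q (-q ^ 2 / (t2 * t3)) n) *
            (t1 ^ 2 / q ^ 3) ^ n
        else 0 := by
  refine ⟨integrable_moment hq0 hq1 ht1.le ht2.le ht3.le, fun m n => ?_⟩
  rw [integral_Vp_mul_Vp hq0 hq1 ht1 ht2 ht3]
  split_ifs with h
  · rw [h, weightFunctional_vPoly_mul_self hq0 hq1 ht1 ht2 ht3]
  · rcases lt_or_gt_of_ne h with h | h
    · exact weightFunctional_vPoly_mul_vPoly_of_lt hq0 hq1 ht1 ht2 ht3 h
    · rw [mul_comm, weightFunctional_vPoly_mul_vPoly_of_lt hq0 hq1 ht1 ht2 ht3 h]
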